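/- arXiv:math/0210212 — 12 statements merged into one kernel-verified Lean document; each statement's English description precedes it below -/
import Mathlib

section
/- Let k ≥ 1, let c, d ∈ ℂ and a, b ∈ ℂ^k. Regard ℂ^k as a real inner product space via ⟨x, y⟩ = Re(∑ᵢ xᵢ · conj(yᵢ)). Then the set { ((t·c + d)⁻¹) • (t • a + b) : t ∈ ℝ, t·c + d ≠ 0 } lies on a circle, i.e. it is concyclic or collinear. (This is the complex case of the lemma: the fractional linear map x ↦ (xc+d)⁻¹(xa+b) from ℂ to ℂ^k takes every real line to a circle, since the restriction of that map to any real line in ℂ has exactly this parametrized form.) -/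
/-- The points `p + w • v`, with `w` ranging over `ℂ`, are coplanar over `ℝ`. -/
theorem coplanar_complex_line {V : Type*} [AddCommGroup V] [Module ℂ V] [Module ℝ V]
    [IsScalarTower ℝ ℂ V] (p v : V) : Coplanar ℝ (Set.range fun w : ℂ => p + w • v) := by
  have hle : vectorSpan ℝ (Set.range fun w : ℂ => p + w • v) ≤
      LinearMap.range ((LinearMap.toSpanSingleton ℂ V v).restrictScalars ℝ) := by
    refine Submodule.span_le.2 ?_
    rintro _ ⟨_, ⟨w, rfl⟩, _, ⟨u, rfl⟩, rfl⟩
    exact ⟨w - u, by simp [sub_smul]⟩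
  refine (Submodule.rank_mono hle).trans ?_
  rw [← Module.finrank_eq_rank]
  have h := LinearMap.finrank_range_le ((LinearMap.toSpanSingleton ℂ V v).restrictScalars ℝ)
  rw [Complex.finrank_real_complex] at h
  exact_mod_cast h

/-- Inversion sends the horizontal line `Im = s` to the circle of radius `1 / (2 |s|)` centred
at `1 / (2 i s)`. -/
theorem norm_inv_sub_inv_two_mul_im (z : ℂ) (hz : z.im ≠ 0) :
    ‖z⁻¹ - (2 * Complex.I * z.im)⁻¹‖ = (2 * |z.im|)⁻¹ := by
  have hz0 : z ≠ 0 := fun h => hz (by simp [h])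
  have hs : (z.im : ℂ) ≠ 0 := by exact_mod_cast hz
  have hden : 2 * Complex.I * (z.im : ℂ) ≠ 0 := by simp [hz]
  have hconj : 2 * Complex.I * (z.im : ℂ) - z = -(starRingEnd ℂ z) := by
    apply Complex.ext
    · simp
    · simp; ring
  rw [inv_sub_inv hz0 hden, hconj, norm_div, norm_neg, RCLike.norm_conj, norm_mul]
  have hn : ‖z‖ ≠ 0 := norm_ne_zero_iff.2 hz0
  have hm : ‖2 * Complex.I * (z.im : ℂ)‖ = 2 * |z.im| := by simp
  have ha : |z.im| ≠ 0 := abs_ne_zero.2 hz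
  rw [hm]
  field_simp

/-- The complex case of the lemma: the fractional linear map
`x ↦ (xc+d)⁻¹(xa+b)` from `ℂ` to `ℂ^k`, restricted to a real line (here the real
axis, parametrized by `t`), has image lying on a circle (concyclic or collinear)
in `ℂ^k`, viewed as a real inner product space. -/
theorem stmt0 (k : ℕ) (hk : 1 ≤ k) (c d : ℂ) (a b : EuclideanSpace ℂ (Fin k)) :
    EuclideanGeometry.Concyclic
        {z : EuclideanSpace ℂ (Fin k) |
          ∃ t : ℝ, (t : ℂ) * c + d ≠ 0 ∧ z = ((t : ℂ) * c + d)⁻¹ • ((t : ℂ) • a + b)} ∨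
      Collinear ℝ
        {z : EuclideanSpace ℂ (Fin k) |
          ∃ t : ℝ, (t : ℂ) * c + d ≠ 0 ∧ z = ((t : ℂ) * c + d)⁻¹ • ((t : ℂ) • a + b)} := by
  by_cases hc : c = 0
  · right
    rw [collinear_iff_exists_forall_eq_smul_vadd]
    refine ⟨d⁻¹ • b, d⁻¹ • a, ?_⟩
    rintro _ ⟨t, -, rfl⟩
    refine ⟨t, ?_⟩
    rw [← Complex.coe_smul t (d⁻¹ • a), vadd_eq_add, hc, mul_zero, zero_add]
    module
  set u := d / c with hu
  set v := c⁻¹ • (b - u • a) with hv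
  have hd : d = u * c := by rw [hu]; field_simp
  have key : ∀ t : ℝ, (t : ℂ) * c + d ≠ 0 → (t : ℂ) + u ≠ 0 ∧
      ((t : ℂ) * c + d)⁻¹ • ((t : ℂ) • a + b) = c⁻¹ • a + ((t : ℂ) + u)⁻¹ • v := by
    intro t ht
    have hfac : (t : ℂ) * c + d = ((t : ℂ) + u) * c := by rw [hd]; ring
    have htu : (t : ℂ) + u ≠ 0 := fun h => ht (by rw [hfac, h, zero_mul])
    refine ⟨htu, ?_⟩
    rw [hfac, hv]
    match_scalars <;> field_simp
    ring
  by_cases hs : u.im = 0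
  · right
    rw [collinear_iff_exists_forall_eq_smul_vadd]
    refine ⟨c⁻¹ • a, v, ?_⟩
    rintro _ ⟨t, ht, rfl⟩
    refine ⟨(t + u.re)⁻¹, ?_⟩
    have hre : u = (u.re : ℂ) := Complex.ext (by simp) (by simp [hs])
    rw [(key t ht).2, ← Complex.coe_smul _ v, vadd_eq_add, add_comm]
    push_cast
    rw [← hre]
  · left
    refine ⟨⟨c⁻¹ • a + (2 * Complex.I * u.im)⁻¹ • v, (2 * |u.im|)⁻¹ * ‖v‖, ?_⟩, ?_⟩
    · rintro _ ⟨t, ht, rfl⟩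
      have him : ((t : ℂ) + u).im = u.im := by simp
      have h := norm_inv_sub_inv_two_mul_im ((t : ℂ) + u) (by rwa [him])
      rw [him] at h
      rw [(key t ht).2, dist_add_left, dist_eq_norm, ← sub_smul, norm_smul, h]
    · refine (coplanar_complex_line (c⁻¹ • a) v).subset ?_
      rintro _ ⟨t, ht, rfl⟩
      exact ⟨((t : ℂ) + u)⁻¹, (key t ht).2.symm⟩
end

section
/- Let k ≥ 1, let c, d ∈ ℍ (quaternions) and a, b ∈ ℍ^k. Regard ℍ^k as a real inner product space via ⟨x, y⟩ = Re(∑ᵢ xᵢ · conj(yᵢ)). Then the set { ((t·c + d)⁻¹) • (t • a + b) : t ∈ ℝ, t·c + d ≠ 0 } lies on a circle, i.e. it is concyclic or collinear, where q • v denotes coordinatewise left multiplication of the vector v ∈ ℍ^k by the quaternion q. (This is the quaternionic case of the lemma: the map x ↦ (xc+d)⁻¹(xa+b) takes real lines to circles.) -/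
open scoped Quaternion

/-- A set whose points all differ from a fixed point by a combination of two fixed vectors
is coplanar. -/
theorem coplanar_of_forall_exists_smul_add_smul {V : Type*} [AddCommGroup V] [Module ℝ V]
    {s : Set V} (p u v : V) (h : ∀ z ∈ s, ∃ x y : ℝ, z = p + (x • u + y • v)) :
    Coplanar ℝ s := by
  have hs : s ⊆ (AffineSubspace.mk' p (Submodule.span ℝ {u, v}) : Set V) := by
    intro z hz
    obtain ⟨x, y, rfl⟩ := h z hz
    rw [SetLike.mem_coe, AffineSubspace.mem_mk', vsub_eq_sub, add_sub_cancel_left,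
      Submodule.mem_span_pair]
    exact ⟨x, y, rfl⟩
  refine Coplanar.subset hs ?_
  rw [Coplanar, ← AffineSubspace.direction_eq_vectorSpan, AffineSubspace.direction_mk']
  refine (rank_span_le _).trans ((Cardinal.mk_insert_le).trans ?_)
  rw [Cardinal.mk_singleton, one_add_one_eq_two]

namespace Quaternion

theorem norm_sub_coe_of_re_eq_zero {p : ℍ} (hp : p.re = 0) (s : ℝ) :
    ‖p - (s : ℍ)‖ = ‖(s : ℍ) + p‖ := by
  rw [← norm_star ((s : ℍ) + p), star_add, star_coe, star_eq_neg.2 hp, ← sub_eq_add_neg,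
    norm_sub_rev]

theorem norm_inv_coe_add_sub_half_inv {p : ℍ} (hp : p.re = 0) (hp0 : p ≠ 0) {s : ℝ}
    (hs : (s : ℍ) + p ≠ 0) :
    ‖((s : ℍ) + p)⁻¹ - (2⁻¹ : ℝ) • p⁻¹‖ = 2⁻¹ * ‖p‖⁻¹ := by
  have h : ((s : ℍ) + p)⁻¹ - (2⁻¹ : ℝ) • p⁻¹ =
      (2⁻¹ : ℝ) • (((s : ℍ) + p)⁻¹ * (p - s) * p⁻¹) := by
    apply mul_left_cancel₀ hs
    apply mul_right_cancel₀ hp0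
    simp only [mul_sub, sub_mul, mul_smul_comm, smul_mul_assoc, ← mul_assoc]
    simp only [mul_inv_cancel₀ hs, one_mul, mul_assoc, inv_mul_cancel₀ hp0, mul_one]
    module
  rw [h, norm_smul, norm_mul, norm_mul, norm_inv ((s : ℍ) + p), norm_inv p,
    norm_sub_coe_of_re_eq_zero hp,
    inv_mul_cancel₀ (norm_ne_zero_iff.2 hs), one_mul, Real.norm_of_nonneg (by norm_num)]

theorem inv_coe_add_of_re_eq_zero {p : ℍ} (hp : p.re = 0) (s : ℝ) :
    ((s : ℍ) + p)⁻¹ = (normSq ((s : ℍ) + p))⁻¹ • ((s : ℍ) - p) := by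
  rw [inv_def, star_add, star_coe, star_eq_neg.2 hp, ← sub_eq_add_neg]

theorem coe_smul_eq_smul {V : Type*} [AddCommGroup V] [Module ℝ V] [Module ℍ V]
    [IsScalarTower ℝ ℍ V] (t : ℝ) (v : V) : (t : ℍ) • v = t • v := by
  rw [← algebraMap_def, algebraMap_smul]

/-- With `q = d * c⁻¹`, the fractional linear map is an affine function of the inverse of
`t + q = (t + q.re) + q.im`. -/
theorem inv_smul_smul_add_eq {V : Type*} [AddCommGroup V] [Module ℍ V] {c d : ℍ} (hc : c ≠ 0)
    {t : ℝ} (ht : (t : ℍ) * c + d ≠ 0) (a b : V) :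
    ((t : ℍ) * c + d)⁻¹ • ((t : ℍ) • a + b) =
      c⁻¹ • a + c⁻¹ • (((t + (d * c⁻¹).re : ℝ) : ℍ) + (d * c⁻¹).im)⁻¹ •
        (b - (d * c⁻¹) • a) := by
  have h : ((t + (d * c⁻¹).re : ℝ) : ℍ) + (d * c⁻¹).im = (t : ℍ) + d * c⁻¹ := by
    rw [coe_add, add_assoc, re_add_im]
  have h' : (t : ℍ) * c + d = ((t : ℍ) + d * c⁻¹) * c := by
    rw [add_mul, inv_mul_cancel_right₀ hc]
  have hq : (t : ℍ) + d * c⁻¹ ≠ 0 := fun h0 ↦ ht (by rw [h', h0, zero_mul])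
  have hb : (t : ℍ) • a + b = ((t : ℍ) + d * c⁻¹) • a + (b - (d * c⁻¹) • a) := by
    rw [add_smul]; abel
  rw [h, h', hb, mul_inv_rev, mul_smul, smul_add, smul_add, inv_smul_smul₀ hq]

theorem coe_add_im_ne_zero {c d : ℍ} (hc : c ≠ 0) {t : ℝ} (ht : (t : ℍ) * c + d ≠ 0) :
    ((t + (d * c⁻¹).re : ℝ) : ℍ) + (d * c⁻¹).im ≠ 0 := by
  rw [coe_add, add_assoc, re_add_im]
  intro h0
  apply ht
  rw [← inv_mul_cancel_right₀ hc d, ← add_mul, h0, zero_mul]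

/-- A fractional linear map of a quaternionic vector space maps the real line into a circle. -/
theorem concyclic_or_collinear_range_fractional_linear {V : Type*} [NormedAddCommGroup V]
    [InnerProductSpace ℝ V] [Module ℍ V] [IsScalarTower ℝ ℍ V] [NormSMulClass ℍ V]
    (c d : ℍ) (a b : V) :
    EuclideanGeometry.Concyclic
        {z : V | ∃ t : ℝ, (t : ℍ) * c + d ≠ 0 ∧
          z = ((t : ℍ) * c + d)⁻¹ • ((t : ℍ) • a + b)} ∨
      Collinear ℝ
        {z : V | ∃ t : ℝ, (t : ℍ) * c + d ≠ 0 ∧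
          z = ((t : ℍ) * c + d)⁻¹ • ((t : ℍ) • a + b)} := by
  by_cases hc : c = 0
  · right
    rw [collinear_iff_exists_forall_eq_smul_vadd]
    refine ⟨d⁻¹ • b, d⁻¹ • a, ?_⟩
    rintro _ ⟨t, -, rfl⟩
    refine ⟨t, ?_⟩
    rw [hc, mul_zero, zero_add, smul_add, vadd_eq_add, ← coe_smul_eq_smul t, smul_smul, smul_smul,
      coe_commutes t d⁻¹]
  set p := (d * c⁻¹).im
  set r := (d * c⁻¹).re
  set e := b - (d * c⁻¹) • a
  have hp0 : p.re = 0 := re_im _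
  have hz : ∀ t : ℝ, (t : ℍ) * c + d ≠ 0 → ((t : ℍ) * c + d)⁻¹ • ((t : ℍ) • a + b) =
      c⁻¹ • a + c⁻¹ • (((t + r : ℝ) : ℍ) + p)⁻¹ • e :=
    fun t ht ↦ inv_smul_smul_add_eq hc ht a b
  by_cases h0 : p = 0
  · right
    rw [collinear_iff_exists_forall_eq_smul_vadd]
    refine ⟨c⁻¹ • a, c⁻¹ • e, ?_⟩
    rintro _ ⟨t, ht, rfl⟩
    refine ⟨(t + r)⁻¹, ?_⟩
    rw [hz t ht, h0, add_zero, vadd_eq_add, add_comm, ← coe_inv, ← coe_smul_eq_smul (t + r)⁻¹,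
      smul_smul, smul_smul, coe_commutes _ c⁻¹]
  · left
    constructor
    · refine ⟨c⁻¹ • a + c⁻¹ • ((2⁻¹ : ℝ) • p⁻¹) • e, ‖c⁻¹‖ * (2⁻¹ * ‖p‖⁻¹ * ‖e‖), ?_⟩
      rintro _ ⟨t, ht, rfl⟩
      rw [hz t ht, dist_add_left, dist_eq_norm, ← smul_sub, ← sub_smul, norm_smul, norm_smul,
        norm_inv_coe_add_sub_half_inv hp0 h0 (coe_add_im_ne_zero hc ht)]
    · refine coplanar_of_forall_exists_smul_add_smul (c⁻¹ • a) (c⁻¹ • e) (c⁻¹ • p • e) ?_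
      rintro _ ⟨t, ht, rfl⟩
      refine ⟨(normSq (((t + r : ℝ) : ℍ) + p))⁻¹ * (t + r),
        -(normSq (((t + r : ℝ) : ℍ) + p))⁻¹, ?_⟩
      rw [hz t ht, inv_coe_add_of_re_eq_zero hp0]
      simp only [← coe_smul_eq_smul (V := V), smul_smul, smul_sub, ← add_smul]
      congr 2
      generalize (normSq (((t + r : ℝ) : ℍ) + p))⁻¹ = n
      rw [coe_mul_eq_smul, coe_mul_eq_smul, mul_sub, mul_smul_comm, mul_smul_comm, ← coe_commutes,
        coe_mul_eq_smul]
      module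

end Quaternion


/-- The quaternionic case of the lemma: the fractional linear map
`x ↦ (xc+d)⁻¹(xa+b)` from `ℍ` to `ℍ^k`, restricted to a real line (here the real
axis, parametrized by `t`), has image lying on a circle (concyclic or collinear)
in `ℍ^k`, viewed as a real inner product space, where `q • v` is coordinatewise
left multiplication by the quaternion `q`. -/
theorem stmt1 (k : ℕ) (hk : 1 ≤ k) (c d : Quaternion ℝ)
    (a b : PiLp 2 fun _ : Fin k => Quaternion ℝ) :
    EuclideanGeometry.Concyclic
        {z : PiLp 2 fun _ : Fin k => Quaternion ℝ |
          ∃ t : ℝ, (t : Quaternion ℝ) * c + d ≠ 0 ∧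
            z = ((t : Quaternion ℝ) * c + d)⁻¹ • ((t : Quaternion ℝ) • a + b)} ∨
      Collinear ℝ
        {z : PiLp 2 fun _ : Fin k => Quaternion ℝ |
          ∃ t : ℝ, (t : Quaternion ℝ) * c + d ≠ 0 ∧
            z = ((t : Quaternion ℝ) * c + d)⁻¹ • ((t : Quaternion ℝ) • a + b)} := by
  exact Quaternion.concyclic_or_collinear_range_fractional_linear c d a b
end

section
/- Let A, B : ℍ → ℍ be affine maps of real vector spaces (i.e. each is the sum of an ℝ-linear map and a constant; they need not be ℍ-linear). Then the fractional quaternionic transformation x ↦ B(x)⁻¹ · A(x) takes every straight line to a circle: for all u, w ∈ ℍ, the set { B(u + t•w)⁻¹ · A(u + t•w) : t ∈ ℝ, B(u + t•w) ≠ 0 } lies on a circle (is concyclic or collinear) in ℍ, regarded as the Euclidean space ℝ⁴ with inner product ⟨x, y⟩ = Re(x · conj y). -/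
/-- If the coset `f + V` of the span of two vectors contains `s`, then `s` is coplanar. -/
theorem coplanar_of_forall_sub_mem_span_pair {E : Type*} [AddCommGroup E] [Module ℝ E] {s : Set E}
    {f g h : E} (hs : ∀ z ∈ s, z - f ∈ Submodule.span ℝ {g, h}) : Coplanar ℝ s := by
  have hle : vectorSpan ℝ s ≤ Submodule.span ℝ {g, h} := by
    rw [vectorSpan_def, Submodule.span_le]
    rintro _ ⟨x, hx, y, hy, rfl⟩
    simpa using Submodule.sub_mem _ (hs x hx) (hs y hy)
  refine (Submodule.rank_mono hle).trans ((rank_span_le _).trans ?_)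
  refine (Cardinal.mk_insert_le).trans ?_
  rw [Cardinal.mk_singleton, one_add_one_eq_two]

namespace Quaternion

theorem inv_eq_smul_re_sub_im (q : Quaternion ℝ) :
    q⁻¹ = (normSq q)⁻¹ • ((q.re : Quaternion ℝ) - q.im) := by
  have h : (q.re : Quaternion ℝ) - q.im = star q := by ext <;> simp
  rw [h]
  rfl

theorem two_mul_normSq_im_add_mul_im (q : Quaternion ℝ) :
    (2 * normSq q.im) • (1 : Quaternion ℝ) + q * q.im = q.im * star q := by
  ext <;> simp [normSq_def'] <;> ring

/-- Inverses of quaternions with imaginary part `v` lie on a sphere of radius `1 / (2 ‖v‖)`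
centred at `-v / (2 ‖v‖ ^ 2)`. -/
theorem norm_inv_add_smul_im {q : Quaternion ℝ} (hv : q.im ≠ 0) :
    ‖q⁻¹ + (2 * normSq q.im)⁻¹ • q.im‖ = (2 * ‖q.im‖)⁻¹ := by
  have hq : q ≠ 0 := by
    rintro rfl
    simp at hv
  have hn : 2 * normSq q.im ≠ 0 := mul_ne_zero two_ne_zero (normSq_ne_zero.2 hv)
  have key : q⁻¹ + (2 * normSq q.im)⁻¹ • q.im =
      (2 * normSq q.im)⁻¹ • (q⁻¹ * (q.im * star q)) := by
    rw [← two_mul_normSq_im_add_mul_im, mul_add, inv_mul_cancel_left₀ hq, smul_add, mul_smul_comm,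
      mul_one, smul_smul, inv_mul_cancel₀ hn, one_smul]
  have hv' : ‖q.im‖ ≠ 0 := norm_ne_zero_iff.2 hv
  have hq' : ‖q‖ ≠ 0 := norm_ne_zero_iff.2 hq
  rw [key, norm_smul, norm_mul, norm_mul, norm_inv, norm_inv, norm_star, normSq_eq_norm_mul_self,
    Real.norm_of_nonneg (by positivity)]
  field_simp

/-- The curve `t ↦ f + (t + p)⁻¹ * g` lies on a circle. -/
theorem concyclic_or_collinear_add_inv_mul {S : Set (Quaternion ℝ)} (f g p : Quaternion ℝ)
    (hS : ∀ z ∈ S, ∃ t : ℝ, z = f + ((t : Quaternion ℝ) + p)⁻¹ * g) :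
    EuclideanGeometry.Concyclic S ∨ Collinear ℝ S := by
  have him (t : ℝ) : ((t : Quaternion ℝ) + p).im = p.im := by ext <;> simp
  by_cases hv : p.im = 0
  · right
    rw [collinear_iff_exists_forall_eq_smul_vadd]
    refine ⟨f, g, fun z hz => ?_⟩
    obtain ⟨t, rfl⟩ := hS z hz
    rw [inv_eq_smul_re_sub_im, him, hv, sub_zero, smul_mul_assoc, coe_mul_eq_smul, smul_smul]
    exact ⟨_, add_comm _ _⟩
  · refine Or.inl ⟨⟨f - (2 * normSq p.im)⁻¹ • (p.im * g), (2 * ‖p.im‖)⁻¹ * ‖g‖, fun z hz => ?_⟩,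
      coplanar_of_forall_sub_mem_span_pair (f := f) (g := g) (h := p.im * g) fun z hz => ?_⟩
    · obtain ⟨t, rfl⟩ := hS z hz
      have h := norm_inv_add_smul_im (q := (t : Quaternion ℝ) + p) (by rwa [him])
      rw [him] at h
      rw [← h, ← norm_mul, dist_eq_norm, add_mul, smul_mul_assoc]
      congr 1
      abel
    · obtain ⟨t, rfl⟩ := hS z hz
      rw [add_sub_cancel_left, inv_eq_smul_re_sub_im, him, smul_mul_assoc, sub_mul,
        coe_mul_eq_smul]
      refine Submodule.smul_mem _ _ (Submodule.sub_mem _ (Submodule.smul_mem _ _ ?_) ?_)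
      · exact Submodule.subset_span (by simp)
      · exact Submodule.subset_span (by simp)

end Quaternion

/-- Fractional quaternionic transformations take lines to circles: if `A B : ℍ → ℍ`
are affine maps of real vector spaces, then for every line `t ↦ u + t • w` the image
under `x ↦ B(x)⁻¹ * A(x)` lies on a circle (is concyclic or collinear) in `ℍ ≅ ℝ⁴`. -/
theorem stmt2 (A B : Quaternion ℝ →ᵃ[ℝ] Quaternion ℝ) (u w : Quaternion ℝ) :
    EuclideanGeometry.Concyclic
        {z : Quaternion ℝ |
          ∃ t : ℝ, B (u + t • w) ≠ 0 ∧ z = (B (u + t • w))⁻¹ * A (u + t • w)} ∨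
      Collinear ℝ
        {z : Quaternion ℝ |
          ∃ t : ℝ, B (u + t • w) ≠ 0 ∧ z = (B (u + t • w))⁻¹ * A (u + t • w)} := by
  have hline (F : Quaternion ℝ →ᵃ[ℝ] Quaternion ℝ) (t : ℝ) :
      F (u + t • w) = F u + t • F.linear w := by
    rw [add_comm, ← vadd_eq_add, F.map_vadd, map_smul, vadd_eq_add, add_comm]
  simp only [hline]
  by_cases hd : B.linear w = 0
  · right
    rw [collinear_iff_exists_forall_eq_smul_vadd]
    refine ⟨(B u)⁻¹ * A u, (B u)⁻¹ * A.linear w, ?_⟩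
    rintro _ ⟨t, -, rfl⟩
    exact ⟨t, by rw [hd, smul_zero, add_zero, mul_add, mul_smul_comm, vadd_eq_add, add_comm]⟩
  · generalize A u = a, A.linear w = b, B u = c, B.linear w = d at *
    refine Quaternion.concyclic_or_collinear_add_inv_mul
      (d⁻¹ * b) (d⁻¹ * a - d⁻¹ * c * (d⁻¹ * b)) (d⁻¹ * c) ?_
    rintro _ ⟨t, ht, rfl⟩
    refine ⟨t, ?_⟩
    have hden : c + t • d = d * ((t : Quaternion ℝ) + d⁻¹ * c) := by
      rw [mul_add, mul_inv_cancel_left₀ hd, Quaternion.mul_coe_eq_smul, add_comm]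
    rw [hden] at ht ⊢
    have hq := right_ne_zero_of_mul ht
    have hnum : d⁻¹ * (a + t • b) = ((t : Quaternion ℝ) + d⁻¹ * c) * (d⁻¹ * b) +
        (d⁻¹ * a - d⁻¹ * c * (d⁻¹ * b)) := by
      rw [add_mul, Quaternion.coe_mul_eq_smul, mul_add, mul_smul_comm]
      abel
    rw [mul_inv_rev, mul_assoc, hnum, mul_add, inv_mul_cancel_left₀ hq]
end

section
/- Let E be a nontrivial finite-dimensional real inner product space, r ≥ 1, and let Q be the quadratic form Q(w) = −‖w‖² on ℝ^r. Let φ : CliffordAlgebra Q →ₐ[ℝ] (E →ₗ[ℝ] E) be an ℝ-algebra homomorphism compatible with the metric, meaning ‖(s • id + φ(ι w))(x)‖² = (s² + ‖w‖²)·‖x‖² for all s ∈ ℝ, w ∈ ℝ^r, x ∈ E (so the operator T(s,w) := s • id + φ(ι w) is invertible whenever (s,w) ≠ 0). Then the map F_φ : ((s,w), x) ↦ T(s,w)⁻¹(x) takes all straight lines to circles: for all (s₀,w₀,x₀) and (s₁,w₁,x₁) in ℝ × ℝ^r × E, the set { T(s₀ + t·s₁, w₀ + t•w₁)⁻¹ (x₀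 + t•x₁) : t ∈ ℝ, (s₀ + t·s₁, w₀ + t•w₁) ≠ (0,0) } lies on a circle (is concyclic or collinear) in E. -/
section CircleLemmas

theorem sq_add_norm_sq_ne_zero {V : Type*} [NormedAddCommGroup V] {s : ℝ} {w : V} (h : (s, w) ≠ 0) : s ^ 2 + ‖w‖ ^ 2 ≠ 0 := by
  contrapose! h
  have hs : s ^ 2 = 0 := by nlinarith [sq_nonneg s, sq_nonneg ‖w‖]
  have hw : ‖w‖ ^ 2 = 0 := by nlinarith [sq_nonneg s, sq_nonneg ‖w‖]
  simpa using And.intro hs hw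

variable {E : Type*} [NormedAddCommGroup E] [InnerProductSpace ℝ E]

/-- A set contained in the image of an affine line under an inversion (followed by a translation)
is concyclic or collinear. -/
theorem concyclic_or_collinear_of_inversion_line {S : Set E} {p a b : E} {C : ℝ}
    (hS : ∀ y ∈ S, ∃ k t : ℝ, y = p + k • (a + t • b) ∧ k * ‖a + t • b‖ ^ 2 = C) :
    EuclideanGeometry.Concyclic S ∨ Collinear ℝ S := by
  obtain ⟨h, m, rfl, hb⟩ : ∃ (h : E) (m : ℝ), a = h + m • b ∧ inner ℝ b h = 0 := by
    by_cases hb : b = 0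
    · exact ⟨a, 0, by simp, by simp [hb]⟩
    · have hb' : ‖b‖ ^ 2 ≠ 0 := by simpa using hb
      refine ⟨a - (inner ℝ b a / ‖b‖ ^ 2) • b, inner ℝ b a / ‖b‖ ^ 2, by simp, ?_⟩
      rw [inner_sub_right, inner_smul_right, real_inner_self_eq_norm_sq]
      field_simp
      ring
  by_cases hh : h = 0
  · right
    subst hh
    refine (collinear_iff_exists_forall_eq_smul_vadd S).2 ⟨p, b, fun y hy ↦ ?_⟩
    obtain ⟨k, t, rfl, -⟩ := hS y hy
    refine ⟨k * (m + t), ?_⟩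
    rw [vadd_eq_add]
    module
  left
  have hh' : ‖h‖ ^ 2 ≠ 0 := by simpa using hh
  refine ⟨⟨p + (C / ‖h‖ ^ 2 / 2) • h, ‖(C / ‖h‖ ^ 2 / 2) • h‖, fun y hy ↦ ?_⟩, ?_⟩
  · obtain ⟨k, t, rfl, hk⟩ := hS y hy
    set u := h + m • b + t • b with hu
    have hin : inner ℝ u h = ‖h‖ ^ 2 := by
      simp [hu, inner_add_left, inner_smul_left, hb]
    rw [dist_eq_norm, add_sub_add_left_eq_sub, ← sq_eq_sq₀ (norm_nonneg _) (norm_nonneg _),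
      norm_sub_sq_real, norm_smul k, mul_pow, Real.norm_eq_abs, sq_abs, inner_smul_left,
      inner_smul_right, hin]
    simp only [conj_trivial]
    field_simp
    linear_combination k * hk
  · have hle : vectorSpan ℝ S ≤ Submodule.span ℝ {h, b} := by
      refine Submodule.span_le.2 ?_
      rintro _ ⟨y, hy, z, hz, rfl⟩
      obtain ⟨k, t, rfl, -⟩ := hS y hy
      obtain ⟨l, s, rfl, -⟩ := hS z hz
      refine Submodule.mem_span_pair.2 ⟨k - l, k * (m + t) - l * (m + s), ?_⟩
      simp only [vsub_eq_sub]
      module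
    refine (Submodule.rank_mono hle).trans ((rank_span_le _).trans ?_)
    exact (Cardinal.mk_insert_le).trans (by norm_num [one_add_one_eq_two])

variable {V : Type*} [NormedAddCommGroup V] [NormedSpace ℝ V]
  {J : V →ₗ[ℝ] Module.End ℝ E}

theorem smul_id_add_mul_smul_id_sub (hJ : ∀ w, J w * J w = -(‖w‖ ^ 2 • 1)) (s : ℝ) (w : V) :
    (s • 1 + J w) * (s • 1 - J w) = (s ^ 2 + ‖w‖ ^ 2) • 1 ∧
      (s • 1 - J w) * (s • 1 + J w) = (s ^ 2 + ‖w‖ ^ 2) • 1 := by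
  constructor <;>
  · simp only [add_mul, mul_add, mul_sub, sub_mul, smul_mul_assoc, mul_smul_comm, one_mul, mul_one,
      hJ]
    module

theorem isUnit_smul_id_add (hJ : ∀ w, J w * J w = -(‖w‖ ^ 2 • 1)) {s : ℝ} {w : V}
    (h : (s, w) ≠ 0) : IsUnit (s • 1 + J w) := by
  have hq := sq_add_norm_sq_ne_zero h
  obtain ⟨h₁, h₂⟩ := smul_id_add_mul_smul_id_sub hJ s w
  exact ⟨⟨s • 1 + J w, (s ^ 2 + ‖w‖ ^ 2)⁻¹ • (s • 1 - J w),
    by rw [mul_smul_comm, h₁, inv_smul_smul₀ hq], by rw [smul_mul_assoc, h₂, inv_smul_smul₀ hq]⟩,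
    rfl⟩

theorem concyclic_or_collinear_image_line (hJ : ∀ w, J w * J w = -(‖w‖ ^ 2 • 1))
    (hnorm : ∀ (s : ℝ) (w : V) (x : E),
      ‖(s • 1 + J w) x‖ ^ 2 = (s ^ 2 + ‖w‖ ^ 2) * ‖x‖ ^ 2)
    (s₀ s₁ : ℝ) (w₀ w₁ : V) (x₀ x₁ : E) {S : Set E}
    (hS : ∀ y ∈ S, ∃ t : ℝ, (s₀ + t * s₁, w₀ + t • w₁) ≠ 0 ∧
      ((s₀ + t * s₁) • 1 + J (w₀ + t • w₁)) y = x₀ + t • x₁) :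
    EuclideanGeometry.Concyclic S ∨ Collinear ℝ S := by
  have hconj (s : ℝ) (w : V) (x : E) :
      (s • 1 - J w) ((s • 1 + J w) x) = (s ^ 2 + ‖w‖ ^ 2) • x := by
    simpa using LinearMap.congr_fun (smul_id_add_mul_smul_id_sub hJ s w).2 x
  by_cases h₁ : (s₁, w₁) = 0
  · right
    obtain ⟨rfl, rfl⟩ : s₁ = 0 ∧ w₁ = 0 := by simpa using h₁
    refine (collinear_iff_exists_forall_eq_smul_vadd S).2
      ⟨(s₀ ^ 2 + ‖w₀‖ ^ 2)⁻¹ • (s₀ • 1 - J w₀) x₀, (s₀ ^ 2 + ‖w₀‖ ^ 2)⁻¹ • (s₀ • 1 - J w₀) x₁,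
        fun y hy ↦ ?_⟩
    obtain ⟨t, ht, hy⟩ := hS y hy
    simp only [mul_zero, smul_zero, add_zero] at ht hy
    refine ⟨t, ?_⟩
    have := hconj s₀ w₀ y
    rw [hy, map_add, map_smul] at this
    rw [← inv_smul_smul₀ (sq_add_norm_sq_ne_zero ht) y, ← this, vadd_eq_add]
    module
  obtain ⟨p, hp⟩ : ∃ p, (s₁ • 1 + J w₁) p = x₁ :=
    ((Module.End.isUnit_iff _).1 (isUnit_smul_id_add hJ h₁)).surjective x₁
  set c := x₀ - (s₀ • 1 + J w₀) p with hc
  refine concyclic_or_collinear_of_inversion_line (p := p) (a := (s₀ • 1 - J w₀) c)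
    (b := (s₁ • 1 - J w₁) c) (C := ‖c‖ ^ 2) fun y hy ↦ ?_
  obtain ⟨t, ht, hy⟩ := hS y hy
  have hq := sq_add_norm_sq_ne_zero ht
  have hline : (s₀ • 1 - J w₀) c + t • (s₁ • 1 - J w₁) c =
      ((s₀ + t * s₁) • 1 - J (w₀ + t • w₁)) c := by
    simp
    module
  have hz : ((s₀ + t * s₁) • 1 + J (w₀ + t • w₁)) (y - p) = c := by
    rw [map_sub, hy, hc, ← hp]
    simp
    module
  refine ⟨((s₀ + t * s₁) ^ 2 + ‖w₀ + t • w₁‖ ^ 2)⁻¹, t, ?_, ?_⟩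
  · rw [hline, ← hz, hconj, inv_smul_smul₀ hq, add_sub_cancel]
  · have := hnorm (s₀ + t * s₁) (-(w₀ + t • w₁)) c
    rw [map_neg, ← sub_eq_add_neg, norm_neg] at this
    rw [hline, this, inv_mul_cancel_left₀ hq]

end CircleLemmas


/-- The map `F_φ : ((s,w), x) ↦ (s • id + φ(ι w))⁻¹ x` associated with a
representation `φ` of the Clifford algebra of `Q(w) = -‖w‖²` on `ℝ^r`, compatible
with the metric of `E`, takes every straight line to a circle.  The inverse image
`T(s,w)⁻¹ (x₀ + t • x₁)` is encoded as the `y` with `T(s,w) y = x₀ + t • x₁`. -/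
theorem stmt3 (E : Type*) [NormedAddCommGroup E] [InnerProductSpace ℝ E]
    [FiniteDimensional ℝ E] [Nontrivial E]
    (r : ℕ) (hr : 1 ≤ r)
    (Q : QuadraticForm ℝ (EuclideanSpace ℝ (Fin r)))
    (hQ : ∀ w, Q w = -‖w‖ ^ 2)
    (φ : CliffordAlgebra Q →ₐ[ℝ] (E →ₗ[ℝ] E))
    (hφ : ∀ (s : ℝ) (w : EuclideanSpace ℝ (Fin r)) (x : E),
      ‖(s • (LinearMap.id : E →ₗ[ℝ] E) + φ (CliffordAlgebra.ι Q w)) x‖ ^ 2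
        = (s ^ 2 + ‖w‖ ^ 2) * ‖x‖ ^ 2)
    (s₀ s₁ : ℝ) (w₀ w₁ : EuclideanSpace ℝ (Fin r)) (x₀ x₁ : E) :
    (∀ (s : ℝ) (w : EuclideanSpace ℝ (Fin r)), (s, w) ≠ 0 →
      IsUnit ((s • (LinearMap.id : E →ₗ[ℝ] E) + φ (CliffordAlgebra.ι Q w)) :
        Module.End ℝ E)) ∧
    (EuclideanGeometry.Concyclic
        {y : E | ∃ t : ℝ, (s₀ + t * s₁, w₀ + t • w₁) ≠ (0, 0) ∧
          ((s₀ + t * s₁) • (LinearMap.id : E →ₗ[ℝ] E)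
              + φ (CliffordAlgebra.ι Q (w₀ + t • w₁))) y = x₀ + t • x₁} ∨
      Collinear ℝ
        {y : E | ∃ t : ℝ, (s₀ + t * s₁, w₀ + t • w₁) ≠ (0, 0) ∧
          ((s₀ + t * s₁) • (LinearMap.id : E →ₗ[ℝ] E)
              + φ (CliffordAlgebra.ι Q (w₀ + t • w₁))) y = x₀ + t • x₁}) := by
  have hJ (w : EuclideanSpace ℝ (Fin r)) :
      (φ.toLinearMap ∘ₗ CliffordAlgebra.ι Q) w * (φ.toLinearMap ∘ₗ CliffordAlgebra.ι Q) w
        = -(‖w‖ ^ 2 • (1 : Module.End ℝ E)) := by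
    rw [← neg_smul, ← hQ w, ← Algebra.algebraMap_eq_smul_one, ← φ.commutes,
      ← CliffordAlgebra.ι_sq_scalar, map_mul]
    rfl
  exact ⟨fun s w h ↦ isUnit_smul_id_add hJ h,
    concyclic_or_collinear_image_line hJ hφ s₀ s₁ w₀ w₁ x₀ x₁ fun y hy ↦ hy⟩
end

section
/- Let V be a finite-dimensional real inner product space, Q the quadratic form Q(v) = −‖v‖² on V, W a finite-dimensional real vector space, and φ : CliffordAlgebra Q →ₐ[ℝ] (W →ₗ[ℝ] W) an ℝ-algebra homomorphism (a linear representation of Cliff(V) on W). Then there exists an inner product ⟪·,·⟫ on W with which the representation is compatible: for all s ∈ ℝ, v ∈ V and all x, y ∈ W, ⟪(s • id + φ(ι v))(x), (s • id + φ(ι v))(y)⟫ = (s² + ‖v‖²)·⟪x, y⟫; in particular every element of the subspace spanned by 1 and V acts conformally. -/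
/-- Every finite-dimensional real vector space carries a Euclidean inner product. -/
theorem exists_symm_posDef_bilinForm (W : Type*) [AddCommGroup W] [Module ℝ W]
    [FiniteDimensional ℝ W] :
    ∃ B : LinearMap.BilinForm ℝ W, (∀ x y, B x y = B y x) ∧ ∀ x, x ≠ 0 → 0 < B x x := by
  let b := Module.finBasis ℝ W
  refine ⟨∑ i, LinearMap.BilinForm.linMulLin (b.coord i) (b.coord i), fun x y => ?_,
    fun x hx => ?_⟩
  · simp [LinearMap.sum_apply, mul_comm]
  · obtain ⟨i, hi⟩ : ∃ i, b.repr x i ≠ 0 := by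
      by_contra! h
      exact hx (b.repr.map_eq_zero_iff.mp (Finsupp.ext h))
    simp only [LinearMap.sum_apply, LinearMap.BilinForm.linMulLin_apply, Module.Basis.coord_apply]
    exact Finset.sum_pos' (fun j _ => mul_self_nonneg _)
      ⟨i, Finset.mem_univ i, mul_self_pos.mpr hi⟩

/-- Finitely many pairwise anticommuting complex structures on a finite-dimensional real vector
space are isometries of a common Euclidean inner product. -/
theorem exists_bilinForm_isometry_of_anticommute {W ι : Type*} [AddCommGroup W] [Module ℝ W]
    [FiniteDimensional ℝ W] (J : ι → W →ₗ[ℝ] W) (hsq : ∀ i x, J i (J i x) = -x)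
    (hanti : ∀ i j, i ≠ j → ∀ x, J i (J j x) = -J j (J i x)) (S : Finset ι) :
    ∃ B : LinearMap.BilinForm ℝ W, (∀ x y, B x y = B y x) ∧ (∀ x, x ≠ 0 → 0 < B x x) ∧
      ∀ i ∈ S, ∀ x y, B (J i x) (J i y) = B x y := by
  classical
  induction S using Finset.induction_on with
  | empty =>
    obtain ⟨B, hsymm, hpos⟩ := exists_symm_posDef_bilinForm W
    exact ⟨B, hsymm, hpos, by simp⟩
  | insert j S hj ih =>
    obtain ⟨B, hsymm, hpos, hB⟩ := ih
    have hnonneg (x : W) : 0 ≤ B x x := by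
      rcases eq_or_ne x 0 with rfl | hx
      · simp
      · exact (hpos x hx).le
    refine ⟨B + B.compl₁₂ (J j) (J j), fun x y => ?_, fun x hx => ?_, fun i hi x y => ?_⟩
    · simp [hsymm x y, hsymm (J j x)]
    · simpa using add_pos_of_pos_of_nonneg (hpos x hx) (hnonneg (J j x))
    · rcases Finset.mem_insert.mp hi with rfl | hi
      · simp [hsq, add_comm]
      · have hne : j ≠ i := fun h => hj (h ▸ hi)
        simp [hanti j i hne, hB i hi]


/-- For any linear representation `φ` of the Clifford algebra of `Q(v) = -‖v‖²` on a
finite-dimensional real vector space `W`, there exists a Euclidean inner product on `W`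
(a symmetric positive-definite bilinear form `B`) with which the representation is
compatible: every element `s • id + φ(ι v)` of the span of `1` and `V` acts
conformally with factor `s² + ‖v‖²`. -/
theorem stmt4 (V : Type*) [NormedAddCommGroup V] [InnerProductSpace ℝ V]
    [FiniteDimensional ℝ V]
    (W : Type*) [AddCommGroup W] [Module ℝ W] [FiniteDimensional ℝ W]
    (Q : QuadraticForm ℝ V) (hQ : ∀ v, Q v = -‖v‖ ^ 2)
    (φ : CliffordAlgebra Q →ₐ[ℝ] (W →ₗ[ℝ] W)) :
    ∃ B : LinearMap.BilinForm ℝ W,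
      (∀ x y : W, B x y = B y x) ∧
      (∀ x : W, x ≠ 0 → 0 < B x x) ∧
      (∀ (s : ℝ) (v : V) (x y : W),
        B ((s • (LinearMap.id : W →ₗ[ℝ] W) + φ (CliffordAlgebra.ι Q v)) x)
          ((s • (LinearMap.id : W →ₗ[ℝ] W) + φ (CliffordAlgebra.ι Q v)) y)
          = (s ^ 2 + ‖v‖ ^ 2) * B x y) := by
  have hJ (v : V) (x : W) :
      φ (CliffordAlgebra.ι Q v) (φ (CliffordAlgebra.ι Q v) x) = -(‖v‖ ^ 2 • x) := by
    rw [← Module.End.mul_apply, ← map_mul, CliffordAlgebra.ι_sq_scalar, AlgHom.commutes, hQ,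
      Module.algebraMap_end_apply, neg_smul]
  let e := stdOrthonormalBasis ℝ V
  have hsq (i) (x : W) :
      φ (CliffordAlgebra.ι Q (e i)) (φ (CliffordAlgebra.ι Q (e i)) x) = -x := by
    simp [hJ]
  have hanti (i j) (hij : i ≠ j) (x : W) :
      φ (CliffordAlgebra.ι Q (e i)) (φ (CliffordAlgebra.ι Q (e j)) x) =
        -φ (CliffordAlgebra.ι Q (e j)) (φ (CliffordAlgebra.ι Q (e i)) x) := by
    have horth : inner ℝ (e i) (e j) = 0 := e.orthonormal.2 hij
    have hnorm : ‖e i + e j‖ ^ 2 = 2 := by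
      rw [norm_add_sq_real, horth, e.norm_eq_one, e.norm_eq_one]
      norm_num
    have h := hJ (e i + e j) x
    simp only [map_add, LinearMap.add_apply, hsq, hnorm] at h
    linear_combination (norm := module) h
  obtain ⟨B, hsymm, hpos, hB⟩ := exists_bilinForm_isometry_of_anticommute
    (fun i => φ (CliffordAlgebra.ι Q (e i))) hsq hanti Finset.univ
  have hskew (v : V) (x y : W) :
      B (φ (CliffordAlgebra.ι Q v) x) y = -B x (φ (CliffordAlgebra.ι Q v) y) := by
    rw [← e.sum_repr v]
    simp only [map_sum, map_smul, LinearMap.sum_apply, LinearMap.smul_apply,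
      ← Finset.sum_neg_distrib]
    refine Finset.sum_congr rfl fun i _ => ?_
    rw [← hB i (Finset.mem_univ i) _ y]
    simp [hsq]
  refine ⟨B, hsymm, hpos, fun s v x y => ?_⟩
  simp only [LinearMap.add_apply, LinearMap.smul_apply, LinearMap.id_apply, map_add, map_smul,
    smul_eq_mul, hskew v, hJ, map_neg]
  ring
end

section
/- (Hurwitz–Radon theorem, Clifford-algebra form.) Let k ≥ 0, n ≥ 1, and let f : ℝ^{k+1} × ℝ^n → ℝ^n be a bilinear map such that ‖f(α, x)‖ = ‖α‖·‖x‖ for all α ∈ ℝ^{k+1} and x ∈ ℝ^n. Then there exist an orthogonal linear map A₀ : ℝ^n → ℝ^n, an orthonormal basis (α₀, α₁, …, α_k) of ℝ^{k+1}, and linear operators I₁, …, I_k on ℝ^n which are orthogonal (‖Iⱼx‖ = ‖x‖), skew-adjoint (⟨Iⱼx, y⟩ = −⟨x, Iⱼy⟩), satisfy Iⱼ∘Iⱼ = −id, and pairwise anticommute (Iⱼ∘I_m + I_m∘Iⱼ = 0 for j ≠ m) — hence define a representation of the Clifford algebra Cliff(k) on ℝ^n — such that f(α, x) = ⟨α,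 α₀⟩ • (A₀ x) + ∑_{j=1}^{k} ⟨α, αⱼ⟩ • Iⱼ(A₀ x) for all α ∈ ℝ^{k+1}, x ∈ ℝ^n. -/
open scoped RealInnerProductSpace

theorem inner_map_map_self_of_norm_map_eq_mul {V E F : Type*}
    [NormedAddCommGroup V] [InnerProductSpace ℝ V]
    [NormedAddCommGroup E] [InnerProductSpace ℝ E]
    [NormedAddCommGroup F] [InnerProductSpace ℝ F]
    (f : V →ₗ[ℝ] E →ₗ[ℝ] F) (hf : ∀ α x, ‖f α x‖ = ‖α‖ * ‖x‖) (α : V) (x y : E) :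
    ⟪f α x, f α y⟫ = ‖α‖ ^ 2 * ⟪x, y⟫ := by
  have h := norm_add_sq_real (f α x) (f α y)
  rw [← map_add, hf, hf, hf, mul_pow, norm_add_sq_real] at h
  linarith

/-- The polarization in both variables of `‖f α x‖ = ‖α‖ * ‖x‖`. -/
theorem inner_map_map_add_of_norm_map_eq_mul {V E F : Type*}
    [NormedAddCommGroup V] [InnerProductSpace ℝ V]
    [NormedAddCommGroup E] [InnerProductSpace ℝ E]
    [NormedAddCommGroup F] [InnerProductSpace ℝ F]
    (f : V →ₗ[ℝ] E →ₗ[ℝ] F) (hf : ∀ α x, ‖f α x‖ = ‖α‖ * ‖x‖) (α β : V) (x y : E) :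
    ⟪f α x, f β y⟫ + ⟪f β x, f α y⟫ = 2 * ⟪α, β⟫ * ⟪x, y⟫ := by
  have h := inner_map_map_self_of_norm_map_eq_mul f hf (α + β) x y
  simp only [map_add, LinearMap.add_apply, inner_add_left, inner_add_right,
    inner_map_map_self_of_norm_map_eq_mul f hf, norm_add_sq_real] at h
  linarith

/-- Hurwitz–Radon theorem, Clifford-algebra form: a bilinear map
`f : ℝ^{k+1} × ℝ^n → ℝ^n` with `‖f(α,x)‖ = ‖α‖·‖x‖` is of the form
`f(α,x) = ⟨α,α₀⟩ • A₀x + ∑ⱼ ⟨α,αⱼ⟩ • Iⱼ(A₀x)` for an orthogonal map `A₀`, an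
orthonormal basis `(α₀,…,α_k)`, and operators `I₁,…,I_k` that are orthogonal,
skew-adjoint, square to `-id` and pairwise anticommute (a representation of
`Cliff(k)` on `ℝ^n` compatible with the metric). -/
theorem stmt6 (k n : ℕ) (hn : 1 ≤ n)
    (f : EuclideanSpace ℝ (Fin (k + 1)) →ₗ[ℝ]
      EuclideanSpace ℝ (Fin n) →ₗ[ℝ] EuclideanSpace ℝ (Fin n))
    (hf : ∀ (α : EuclideanSpace ℝ (Fin (k + 1))) (x : EuclideanSpace ℝ (Fin n)),
      ‖f α x‖ = ‖α‖ * ‖x‖) :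
    ∃ (A₀ : EuclideanSpace ℝ (Fin n) →ₗ[ℝ] EuclideanSpace ℝ (Fin n))
      (b : OrthonormalBasis (Fin (k + 1)) ℝ (EuclideanSpace ℝ (Fin (k + 1))))
      (I : Fin k → (EuclideanSpace ℝ (Fin n) →ₗ[ℝ] EuclideanSpace ℝ (Fin n))),
      (∀ x, ‖A₀ x‖ = ‖x‖) ∧
      (∀ j x, ‖I j x‖ = ‖x‖) ∧
      (∀ j x y, ⟪I j x, y⟫ = -⟪x, I j y⟫) ∧
      (∀ j, I j ∘ₗ I j = -LinearMap.id) ∧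
      (∀ j m, j ≠ m → I j ∘ₗ I m + I m ∘ₗ I j = 0) ∧
      (∀ (α : EuclideanSpace ℝ (Fin (k + 1))) (x : EuclideanSpace ℝ (Fin n)),
        f α x = ⟪α, b 0⟫ • A₀ x + ∑ j : Fin k, ⟪α, b j.succ⟫ • I j (A₀ x)) := by
  let b := EuclideanSpace.basisFun (Fin (k + 1)) ℝ
  have hb (i : Fin (k + 1)) (x : EuclideanSpace ℝ (Fin n)) : ‖f (b i) x‖ = ‖x‖ := by
    rw [hf, b.norm_eq_one, one_mul]
  let e : EuclideanSpace ℝ (Fin n) ≃ₗᵢ[ℝ] EuclideanSpace ℝ (Fin n) :=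
    LinearIsometry.toLinearIsometryEquiv ⟨f (b 0), hb 0⟩ rfl
  have he (x : EuclideanSpace ℝ (Fin n)) : f (b 0) (e.symm x) = x := e.apply_symm_apply x
  let I (j : Fin k) : EuclideanSpace ℝ (Fin n) →ₗ[ℝ] EuclideanSpace ℝ (Fin n) :=
    f (b j.succ) ∘ₗ e.symm.toLinearEquiv.toLinearMap
  have hI (j : Fin k) (x : EuclideanSpace ℝ (Fin n)) : I j x = f (b j.succ) (e.symm x) := rfl
  have hskew (j : Fin k) (x y : EuclideanSpace ℝ (Fin n)) : ⟪I j x, y⟫ = -⟪x, I j y⟫ := by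
    have h := inner_map_map_add_of_norm_map_eq_mul f hf (b j.succ) (b 0) (e.symm x) (e.symm y)
    rw [he, he, b.inner_eq_zero (Fin.succ_ne_zero j), ← hI, ← hI] at h
    linarith
  have hcomm (j m : Fin k) (x : EuclideanSpace ℝ (Fin n)) :
      I j (I m x) + I m (I j x) = (-2 * ⟪b j.succ, b m.succ⟫) • x := by
    refine ext_inner_right ℝ fun y => ?_
    have h := inner_map_map_add_of_norm_map_eq_mul f hf (b j.succ) (b m.succ)
      (e.symm x) (e.symm y)
    rw [e.symm.inner_map_map] at h
    simp only [← hI] at h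
    rw [inner_add_left, hskew j (I m x), hskew m (I j x), real_inner_smul_left]
    linarith
  refine ⟨f (b 0), b, I, hb 0, fun j x => ?_, hskew, fun j => ?_, fun j m hjm => ?_,
    fun α x => ?_⟩
  · rw [hI, hb, e.symm.norm_map]
  · ext1 x
    have h := hcomm j j x
    rw [b.inner_eq_one, ← two_smul ℝ (I j (I j x)), mul_one, neg_smul, ← smul_neg] at h
    exact smul_right_injective _ (two_ne_zero (α := ℝ)) h
  · ext1 x
    have h := hcomm j m x
    rw [b.inner_eq_zero (by simpa using hjm), mul_zero, zero_smul] at h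
    exact h
  · have hx : e.symm (f (b 0) x) = x := e.symm_apply_apply x
    conv_lhs => rw [← b.sum_repr' α]
    simp only [hI, hx, map_sum, map_smul, LinearMap.sum_apply, LinearMap.smul_apply,
      Fin.sum_univ_succ, real_inner_comm, LinearMap.add_apply, map_add]
end

section
/- Let E₁ and E₂ be real inner product spaces and f : E₁ × E₂ → E₂ a bilinear map satisfying ‖f(α, x)‖ = ‖α‖·‖x‖ for all α ∈ E₁, x ∈ E₂. Then the full polarization identity holds: ⟨f(α, x), f(β, y)⟩ + ⟨f(β, x), f(α, y)⟩ = 2·⟨α, β⟩·⟨x, y⟩ for all α, β ∈ E₁ and x, y ∈ E₂. Equivalently, writing A_α for the operator x ↦ f(α, x) and A* for the adjoint, A_α* A_β + A_β* A_α = 2⟨α, β⟩ · id. -/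
open scoped RealInnerProductSpace

/-- Each operator `f α` of a norm-multiplicative bilinear map scales inner products by `‖α‖ ^ 2`. -/
theorem inner_apply_apply_of_norm_mul {E₁ E₂ F : Type*}
    [NormedAddCommGroup E₁] [InnerProductSpace ℝ E₁]
    [NormedAddCommGroup E₂] [InnerProductSpace ℝ E₂]
    [NormedAddCommGroup F] [InnerProductSpace ℝ F]
    (f : E₁ →ₗ[ℝ] E₂ →ₗ[ℝ] F)
    (hf : ∀ (α : E₁) (x : E₂), ‖f α x‖ = ‖α‖ * ‖x‖) (α : E₁) (x y : E₂) :
    ⟪f α x, f α y⟫ = ‖α‖ ^ 2 * ⟪x, y⟫ := by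
  rw [real_inner_eq_norm_add_mul_self_sub_norm_mul_self_sub_norm_mul_self_div_two,
    real_inner_eq_norm_add_mul_self_sub_norm_mul_self_sub_norm_mul_self_div_two,
    ← map_add, hf, hf, hf]
  ring

/-- Polarization of a norm-multiplicative bilinear map: if `f : E₁ × E₂ → E₂` is
bilinear with `‖f(α,x)‖ = ‖α‖·‖x‖`, then
`⟨f(α,x), f(β,y)⟩ + ⟨f(β,x), f(α,y)⟩ = 2⟨α,β⟩⟨x,y⟩` for all `α, β, x, y`
(equivalently `A_α* A_β + A_β* A_α = 2⟨α,β⟩ • id`). -/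
theorem stmt7 (E₁ E₂ : Type*)
    [NormedAddCommGroup E₁] [InnerProductSpace ℝ E₁]
    [NormedAddCommGroup E₂] [InnerProductSpace ℝ E₂]
    (f : E₁ →ₗ[ℝ] E₂ →ₗ[ℝ] E₂)
    (hf : ∀ (α : E₁) (x : E₂), ‖f α x‖ = ‖α‖ * ‖x‖) :
    ∀ (α β : E₁) (x y : E₂),
      ⟪f α x, f β y⟫ + ⟪f β x, f α y⟫ = 2 * ⟪α, β⟫ * ⟪x, y⟫ := by
  intro α β x y
  have h := inner_apply_apply_of_norm_mul f hf (α + β) x y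
  simp only [map_add, LinearMap.add_apply, inner_add_left, inner_add_right,
    inner_apply_apply_of_norm_mul f hf, norm_add_sq_real] at h
  linarith
end

section
/- Let E be a nontrivial finite-dimensional real inner product space and A : E →ₗ[ℝ] E a linear operator. Then the following are equivalent: (1) there exist p, q ∈ ℝ such that ⟨x, A x⟩ = p·‖x‖² and ‖A x‖² = q·‖x‖² for all x ∈ E (i.e. the quadratic forms ⟨x, Ax⟩ and ⟨Ax, Ax⟩ are divisible by ⟨x, x⟩); (2) A is a complex multiplication: either A = a • id for some a ∈ ℝ, or there exist a, b ∈ ℝ and a linear operator I : E →ₗ[ℝ] E with I ∘ I = −id and ‖I x‖ = ‖x‖ for all x ∈ E (a complex structure compatible with the metric), such that A = a • id + b • I. -/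
open scoped RealInnerProductSpace

/-- A norm-preserving operator mapping every vector to an orthogonal one squares to `-id`. -/
theorem LinearMap.comp_self_eq_neg_id_of_inner_self_eq_zero {E : Type*} [NormedAddCommGroup E]
    [InnerProductSpace ℝ E] {I : E →ₗ[ℝ] E} (hskew : ∀ x, ⟪x, I x⟫ = 0)
    (hnorm : ∀ x, ‖I x‖ = ‖x‖) : I ∘ₗ I = -LinearMap.id := by
  ext x
  have hpol := hskew (x + I x)
  simp only [map_add, inner_add_left, inner_add_right, hskew, real_inner_self_eq_norm_sq,
    hnorm] at hpol
  have hsq : ‖I (I x) + x‖ ^ 2 = 0 := by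
    rw [norm_add_sq_real, hnorm, hnorm, real_inner_comm]
    linarith
  simpa using eq_neg_of_add_eq_zero_left (norm_eq_zero.mp (pow_eq_zero_iff two_ne_zero |>.mp hsq))

/-- A complex structure compatible with the metric maps every vector to an orthogonal one. -/
theorem LinearMap.inner_self_eq_zero_of_comp_self_eq_neg_id {E : Type*} [NormedAddCommGroup E]
    [InnerProductSpace ℝ E] {I : E →ₗ[ℝ] E} (hI : I ∘ₗ I = -LinearMap.id)
    (hnorm : ∀ x, ‖I x‖ = ‖x‖) (x : E) : ⟪x, I x⟫ = 0 := by
  have hIx : I (I x) = -x := by simpa using LinearMap.congr_fun hI x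
  have h := hnorm (x + I x)
  rw [map_add, hIx, ← sub_eq_add_neg] at h
  have h1 := norm_sub_sq_real (I x) x
  have h2 := norm_add_sq_real x (I x)
  rw [h] at h1
  rw [real_inner_comm] at h1
  linarith

/-- Quadratic form `‖a x + b y‖²` for orthogonal `x`, `y`. -/
theorem norm_smul_add_smul_sq_of_inner_eq_zero {E : Type*} [NormedAddCommGroup E]
    [InnerProductSpace ℝ E] {x y : E} (h : ⟪x, y⟫ = 0) (a b : ℝ) :
    ‖a • x + b • y‖ ^ 2 = a ^ 2 * ‖x‖ ^ 2 + b ^ 2 * ‖y‖ ^ 2 := by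
  simp [norm_add_sq_real, inner_smul_left, inner_smul_right, h, norm_smul, mul_pow]

/-- Characterization of complex multiplications: a linear operator `A` on a nontrivial
finite-dimensional real inner product space satisfies `⟨x, Ax⟩ = p‖x‖²` and
`‖Ax‖² = q‖x‖²` for some reals `p, q` iff `A` is a complex multiplication, i.e. a real
multiple of the identity, or `a • id + b • I` for a complex structure `I` compatible
with the metric. -/
theorem stmt8 (E : Type*) [NormedAddCommGroup E] [InnerProductSpace ℝ E]
    [FiniteDimensional ℝ E] [Nontrivial E] (A : E →ₗ[ℝ] E) :
    (∃ p q : ℝ, ∀ x : E, ⟪x, A x⟫ = p * ‖x‖ ^ 2 ∧ ‖A x‖ ^ 2 = q * ‖x‖ ^ 2) ↔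
    ((∃ a : ℝ, A = a • (LinearMap.id : E →ₗ[ℝ] E)) ∨
      (∃ (a b : ℝ) (I : E →ₗ[ℝ] E),
        I ∘ₗ I = -LinearMap.id ∧ (∀ x : E, ‖I x‖ = ‖x‖) ∧
        A = a • (LinearMap.id : E →ₗ[ℝ] E) + b • I)) := by
  constructor
  · rintro ⟨p, q, h⟩
    set J : E →ₗ[ℝ] E := A - p • LinearMap.id with hJ
    have hJx (x : E) : J x = A x - p • x := by simp [hJ]
    have hJskew (x : E) : ⟪x, J x⟫ = 0 := by
      rw [hJx, inner_sub_right, inner_smul_right, real_inner_self_eq_norm_sq, (h x).1, sub_self]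
    have hJnorm (x : E) : ‖J x‖ ^ 2 = (q - p ^ 2) * ‖x‖ ^ 2 := by
      rw [hJx, norm_sub_sq_real, inner_smul_right, real_inner_comm, (h x).1, (h x).2, norm_smul,
        mul_pow, Real.norm_eq_abs, sq_abs]
      ring
    rcases le_or_gt (q - p ^ 2) 0 with hle | hpos
    · refine Or.inl ⟨p, sub_eq_zero.mp (LinearMap.ext fun x => ?_)⟩
      have hx : ‖J x‖ ^ 2 ≤ 0 := by
        rw [hJnorm]
        exact mul_nonpos_of_nonpos_of_nonneg hle (sq_nonneg _)
      exact norm_eq_zero.mp (pow_eq_zero_iff two_ne_zero |>.mp (le_antisymm hx (sq_nonneg _)))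
    · set b := √(q - p ^ 2) with hb
      have hb0 : 0 < b := Real.sqrt_pos.mpr hpos
      have hJnorm' (x : E) : ‖J x‖ = b * ‖x‖ := by
        rw [← sq_eq_sq₀ (norm_nonneg _) (by positivity), hJnorm, mul_pow, hb,
          Real.sq_sqrt hpos.le]
      have hnorm (x : E) : ‖(b⁻¹ • J) x‖ = ‖x‖ := by
        rw [LinearMap.smul_apply, norm_smul, hJnorm', Real.norm_of_nonneg (by positivity),
          inv_mul_cancel_left₀ hb0.ne']
      refine Or.inr ⟨p, b, b⁻¹ • J, ?_, hnorm, ?_⟩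
      · refine LinearMap.comp_self_eq_neg_id_of_inner_self_eq_zero (fun x => ?_) hnorm
        rw [LinearMap.smul_apply, inner_smul_right, hJskew, mul_zero]
      · rw [smul_inv_smul₀ hb0.ne', hJ, add_sub_cancel]
  · rintro (⟨a, rfl⟩ | ⟨a, b, I, hI, hnorm, rfl⟩)
    · refine ⟨a, a ^ 2, fun x => ?_⟩
      simp [inner_smul_right, norm_smul, mul_pow]
    · refine ⟨a, a ^ 2 + b ^ 2, fun x => ?_⟩
      have hskew := LinearMap.inner_self_eq_zero_of_comp_self_eq_neg_id hI hnorm x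
      constructor
      · simp [inner_add_right, inner_smul_right, hskew]
      · simp only [LinearMap.add_apply, LinearMap.smul_apply, LinearMap.id_apply]
        rw [norm_smul_add_smul_sq_of_inner_eq_zero hskew, hnorm, add_mul]
end

section
/- Let E be a nontrivial real inner product space, r ≥ 1, and I₁, …, I_r linear operators on E such that for all real numbers c₀, c₁, …, c_r and all x ∈ E, ‖c₀ • x + ∑_{j=1}^{r} cⱼ • Iⱼ x‖² = (∑_{i=0}^{r} cᵢ²)·‖x‖² (i.e. every element of the linear span of the identity and the Iⱼ acts conformally, with conformal factor the corresponding Euclidean square norm of coefficients). Then each Iⱼ is skew-adjoint, Iⱼ ∘ Iⱼ = −id, and Iⱼ ∘ I_m + I_m ∘ Iⱼ = 0 for j ≠ m. Consequently there exists an ℝ-algebra homomorphism φ : CliffordAlgebra Q →ₐ[ℝ] (E →ₗ[ℝ] E), where Q is the quadratic form Q(w) = −‖w‖² on ℝ^r, with φ(ι(eⱼ)) = Iⱼ for each standard basis vector eⱼ of ℝ^r. -/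
open scoped RealInnerProductSpace

section Conformal

variable {E : Type*} [NormedAddCommGroup E] [InnerProductSpace ℝ E]

theorem LinearMap.inner_map_eq_neg_of_conformal {T : E →ₗ[ℝ] E} {k : ℝ}
    (h : ∀ (a : ℝ) (x : E), ‖a • x + T x‖ ^ 2 = (a ^ 2 + k) * ‖x‖ ^ 2) (x y : E) :
    ⟪T x, y⟫ = -⟪x, T y⟫ := by
  have key : ∀ z : E, ⟪z, T z⟫ = 0 := fun z => by
    have h0 := h 0 z
    have h1 := h 1 z
    rw [zero_smul, zero_add] at h0
    rw [one_smul, norm_add_sq_real] at h1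
    linarith
  have hxy := key (x + y)
  rw [map_add, inner_add_left, inner_add_right, inner_add_right, key x, key y] at hxy
  linarith [real_inner_comm y (T x)]

theorem LinearMap.mul_self_eq_neg_of_conformal {T : E →ₗ[ℝ] E} {k : ℝ}
    (h : ∀ (a : ℝ) (x : E), ‖a • x + T x‖ ^ 2 = (a ^ 2 + k) * ‖x‖ ^ 2) :
    T * T = algebraMap ℝ (E →ₗ[ℝ] E) (-k) := by
  have hnorm : ∀ x, ‖T x‖ ^ 2 = k * ‖x‖ ^ 2 := fun x => by simpa using h 0 x
  ext x
  have hskew := inner_map_eq_neg_of_conformal h x (T x)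
  rw [real_inner_self_eq_norm_sq, hnorm] at hskew
  have hzero : ‖k • x + T (T x)‖ ^ 2 = 0 := by
    rw [norm_add_sq_real, real_inner_smul_left, norm_smul, mul_pow, Real.norm_eq_abs, sq_abs,
      hnorm, hnorm]
    linear_combination 2 * k * hskew
  rw [Module.End.mul_apply, Module.algebraMap_end_apply, neg_smul]
  exact eq_neg_of_add_eq_zero_right (norm_eq_zero.mp (pow_eq_zero_iff two_ne_zero |>.mp hzero))

end Conformal

/-- If every element of the span of the identity and operators `I₁, …, I_r` on a
nontrivial real inner product space acts conformally with factor the Euclidean square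
norm of the coefficients, then the `Iⱼ` are skew-adjoint, square to `-id`, pairwise
anticommute, and hence define a representation of the Clifford algebra `Cliff(r)`
(of `Q(w) = -‖w‖²` on `ℝ^r`) with `φ(ι(eⱼ)) = Iⱼ`. -/
theorem stmt11 (E : Type*) [NormedAddCommGroup E] [InnerProductSpace ℝ E]
    [Nontrivial E] (r : ℕ) (hr : 1 ≤ r)
    (I : Fin r → (E →ₗ[ℝ] E))
    (hconf : ∀ (c₀ : ℝ) (c : Fin r → ℝ) (x : E),
      ‖c₀ • x + ∑ j : Fin r, c j • I j x‖ ^ 2 = (c₀ ^ 2 + ∑ j : Fin r, c j ^ 2) * ‖x‖ ^ 2)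
    (Q : QuadraticForm ℝ (EuclideanSpace ℝ (Fin r)))
    (hQ : ∀ w, Q w = -‖w‖ ^ 2) :
    (∀ j, ∀ x y : E, ⟪I j x, y⟫ = -⟪x, I j y⟫) ∧
    (∀ j, I j ∘ₗ I j = -LinearMap.id) ∧
    (∀ j m, j ≠ m → I j ∘ₗ I m + I m ∘ₗ I j = 0) ∧
    (∃ φ : CliffordAlgebra Q →ₐ[ℝ] (E →ₗ[ℝ] E),
      ∀ j : Fin r, φ (CliffordAlgebra.ι Q (EuclideanSpace.single j 1)) = I j) := by
  have hsingle : ∀ j, ∑ i, (EuclideanSpace.single j (1 : ℝ) : EuclideanSpace ℝ (Fin r)) i • I i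
      = I j := fun j => by
    rw [Finset.sum_eq_single j] <;> simp +contextual
  let f : EuclideanSpace ℝ (Fin r) →ₗ[ℝ] (E →ₗ[ℝ] E) :=
    { toFun := fun w => ∑ i, w i • I i
      map_add' := fun v w => by simp [add_smul, Finset.sum_add_distrib]
      map_smul' := fun a w => by simp [mul_smul, Finset.smul_sum] }
  have hf : ∀ w (a : ℝ) (x : E), ‖a • x + f w x‖ ^ 2 = (a ^ 2 + ‖w‖ ^ 2) * ‖x‖ ^ 2 :=
    fun w a x => by
      simpa [f, LinearMap.sum_apply, EuclideanSpace.real_norm_sq_eq] using hconf a w x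
  have hfsq : ∀ w, f w * f w = algebraMap ℝ _ (Q w) := fun w => by
    rw [hQ]
    exact LinearMap.mul_self_eq_neg_of_conformal (hf w)
  have hfe : ∀ j, f (EuclideanSpace.single j 1) = I j := hsingle
  let φ := CliffordAlgebra.lift Q ⟨f, hfsq⟩
  have hφ : ∀ j, φ (CliffordAlgebra.ι Q (EuclideanSpace.single j 1)) = I j := fun j => by
    rw [CliffordAlgebra.lift_ι_apply, hfe]
  refine ⟨fun j x y => ?_, fun j => ?_, fun j m hjm => ?_, φ, hφ⟩
  · rw [← hfe]
    exact LinearMap.inner_map_eq_neg_of_conformal (hf _) x y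
  · have h := hfsq (EuclideanSpace.single j 1)
    rw [hfe, hQ] at h
    rw [← Module.End.mul_eq_comp, h]
    ext x
    simp
  · have hortho : Q.IsOrtho (EuclideanSpace.single j 1) (EuclideanSpace.single m 1) := by
      rw [QuadraticMap.isOrtho_def, hQ, hQ, hQ, norm_add_sq_real]
      simp [EuclideanSpace.inner_single_left, hjm]
    have h := congrArg φ (CliffordAlgebra.ι_mul_ι_add_swap_of_isOrtho hortho)
    rwa [map_add, map_mul, map_mul, hφ, hφ, map_zero] at h
end

section
/- (Micro-local theorem.) Let n ≥ 2, r ≥ 1, let U be a neighborhood of 0 in ℝ^r × ℝ^n, and let Φ : U → ℝ^n be a real-analytic map which is a local projection: Φ(0, x) = x whenever (0, x) ∈ U. Assume: (i) Φ takes germs of vector lines to germs of circles, i.e. for every v ∈ ℝ^r × ℝ^n there exists ε > 0 such that the set { Φ(t • v) : |t| < ε } lies on a circle (is concyclic or collinear); (ii) the images of lines not lying in ℝ^n do not degenerate to lines: for every v = (α, x₀) with α ≠ 0 and x₀ ≠ 0 and every ε > 0 small enough that t•v ∈ U for |t| < ε, the set { Φ(t • v) : |t| < ε } is not collinear. Then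 there exist s ≥ 0, linear operators I₁, …, I_s on ℝ^n that are skew-adjoint, satisfy Iⱼ∘Iⱼ = −id, preserve the norm, and pairwise anticommute (a representation of Cliff(s) on ℝ^n compatible with the metric), and linear maps L : ℝ^r → ℝ^s and M : ℝ^r → ℝ^n with α ↦ (L α, M α) injective, such that, setting F(β, x) = (id − ∑_{j=1}^{s} βⱼ • Iⱼ)⁻¹ (x) for β ∈ ℝ^s, x ∈ ℝ^n, the maps Φ and F∘ψ (where ψ(α, x) = (L α, x + M α)) send every germ of vector line to the same circle: for every v = (α, x₀) ∈ ℝ^r × ℝ^n there exists ε > 0 such that the union { Φ(t • v) : |t| < ε } ∪ { F(t • Lα, t • (x₀ + Mα)) : t ∈ ℝ, id − t•∑ⱼ (Lα)ⱼ • Iⱼ invertible } lies on a single circle (is concyclic or collinear). -/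
open scoped RealInnerProductSpace

section CircleJets

open Filter Topology Asymptotics

section Jets

/-- A vector-valued polynomial of degree less than `n` which is `O(t ^ n)` at `0` vanishes. -/
theorem coeff_eq_zero_of_isBigO_pow {F : Type*} [NormedAddCommGroup F] [NormedSpace ℝ F]
    (n : ℕ) (c : ℕ → F)
    (h : (fun t : ℝ => ∑ i ∈ Finset.range n, t ^ i • c i) =O[𝓝[≠] 0] fun t : ℝ => t ^ n) :
    ∀ i < n, c i = 0 := by
  induction n generalizing c with
  | zero => intro i hi; omega
  | succ n ih =>
    have h0 : c 0 = 0 := by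
      have h1 : Tendsto (fun t : ℝ => ∑ i ∈ Finset.range (n + 1), t ^ i • c i) (𝓝[≠] 0)
          (𝓝 (∑ i ∈ Finset.range (n + 1), (0 : ℝ) ^ i • c i)) :=
        (Continuous.tendsto (by fun_prop) 0).mono_left nhdsWithin_le_nhds
      have h2 : Tendsto (fun t : ℝ => t ^ (n + 1)) (𝓝[≠] 0) (𝓝 ((0 : ℝ) ^ (n + 1))) :=
        (Continuous.tendsto (by fun_prop) 0).mono_left nhdsWithin_le_nhds
      rw [zero_pow n.succ_ne_zero] at h2
      have h3 := tendsto_nhds_unique h1 (h.trans_tendsto h2)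
      simpa [Finset.sum_range_succ'] using h3
    have h4 : (fun t : ℝ => ∑ i ∈ Finset.range n, t ^ i • c (i + 1))
        =O[𝓝[≠] 0] fun t : ℝ => t ^ n := by
      have h5 := (isBigO_refl (fun t : ℝ => t⁻¹) (𝓝[≠] 0)).smul h
      refine (h5.congr' ?_ ?_)
      · filter_upwards [self_mem_nhdsWithin] with t ht
        have ht : t ≠ 0 := ht
        rw [Finset.sum_range_succ', h0, smul_zero, add_zero, Finset.smul_sum]
        refine Finset.sum_congr rfl fun i _ => ?_
        rw [smul_smul, pow_succ']
        field_simp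
      · filter_upwards [self_mem_nhdsWithin] with t ht
        have ht : t ≠ 0 := ht
        rw [smul_eq_mul, pow_succ']
        field_simp
    intro i hi
    cases i with
    | zero => exact h0
    | succ i => exact ih _ h4 i (by omega)

/-- `γ` has the Taylor polynomial `∑ i < 5, t ^ i • p i` of order four at `0`. -/
def HasJet {E : Type*} [NormedAddCommGroup E] [NormedSpace ℝ E] (γ : ℝ → E) (p : ℕ → E) : Prop :=
  (fun t : ℝ => γ t - ∑ i ∈ Finset.range 5, t ^ i • p i) =O[𝓝[≠] 0] fun t : ℝ => t ^ 5

variable {E : Type*} [NormedAddCommGroup E] [InnerProductSpace ℝ E]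

theorem HasJet.coeff_eq {γ : ℝ → E} {p q : ℕ → E} (hp : HasJet γ p) (hq : HasJet γ q) :
    ∀ i < 5, p i = q i := by
  have h : (fun t : ℝ => ∑ i ∈ Finset.range 5, t ^ i • (p i - q i))
      =O[𝓝[≠] 0] fun t : ℝ => t ^ 5 := by
    refine (hq.sub hp).congr_left fun t => ?_
    simp only [smul_sub, Finset.sum_sub_distrib]
    abel
  intro i hi
  exact sub_eq_zero.1 (coeff_eq_zero_of_isBigO_pow 5 _ h i hi)

theorem HasJet.congr {γ δ : ℝ → E} {p : ℕ → E} (hp : HasJet γ p)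
    (h : ∀ᶠ t in 𝓝[≠] 0, γ t = δ t) : HasJet δ p := by
  refine IsBigO.congr' hp ?_ EventuallyEq.rfl
  filter_upwards [h] with t ht
  rw [ht]

theorem HasJet.mem [FiniteDimensional ℝ E] {γ : ℝ → E} {p : ℕ → E} (hp : HasJet γ p)
    {W : Submodule ℝ E} (h : ∀ᶠ t in 𝓝[≠] 0, γ t ∈ W) : ∀ i < 5, p i ∈ W := by
  intro i hi
  rw [← W.orthogonal_orthogonal, Submodule.mem_orthogonal]
  intro m hm
  have h1 : (fun t : ℝ => ∑ i ∈ Finset.range 5, t ^ i • ⟪m, p i⟫)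
      =O[𝓝[≠] 0] fun t : ℝ => t ^ 5 := by
    have h2 := ((innerSL ℝ m).isBigO_comp _ _).trans hp
    refine (h2.neg_left).congr' ?_ EventuallyEq.rfl
    filter_upwards [h] with t ht
    have h3 : ⟪m, γ t⟫ = 0 := (Submodule.mem_orthogonal' W m).1 hm _ ht
    simp only [innerSL_apply_apply, inner_sub_right, h3, inner_sum, inner_smul_right, smul_eq_mul]
    ring
  exact coeff_eq_zero_of_isBigO_pow 5 _ h1 i hi

/-- The relations between the Taylor coefficients of a curve lying on a sphere through `0`. -/
theorem HasJet.sphere {γ : ℝ → E} {p : ℕ → E} (hp : HasJet γ p) (hp0 : p 0 = 0) {c : E}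
    (h : ∀ᶠ t in 𝓝[≠] 0, ⟪γ t, γ t⟫ = 2 * ⟪c, γ t⟫) :
    ⟪c, p 1⟫ = 0 ∧ 2 * ⟪c, p 2⟫ = ⟪p 1, p 1⟫ ∧ ⟪c, p 3⟫ = ⟪p 1, p 2⟫ ∧
      2 * ⟪c, p 4⟫ = 2 * ⟪p 1, p 3⟫ + ⟪p 2, p 2⟫ := by
  set S : ℝ → E := fun t => ∑ i ∈ Finset.range 5, t ^ i • p i with hS
  have hSc : Continuous S := by rw [hS]; fun_prop
  have hpow : ∀ k : ℕ, (fun t : ℝ => t ^ k) =O[𝓝[≠] 0] fun _ : ℝ => (1 : ℝ) := fun k =>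
    (((continuous_pow k).tendsto (0 : ℝ)).mono_left nhdsWithin_le_nhds).isBigO_one ℝ
  have hSb : S =O[𝓝[≠] 0] fun _ => (1 : ℝ) :=
    ((hSc.tendsto 0).mono_left nhdsWithin_le_nhds).isBigO_one ℝ
  have hR : (fun t => γ t - S t) =O[𝓝[≠] 0] fun t : ℝ => t ^ 5 := hp
  have hγb : γ =O[𝓝[≠] 0] fun _ => (1 : ℝ) := by
    refine ((hR.trans (hpow 5)).add hSb).congr_left fun t => by simp
  have hinner : ∀ f g : ℝ → E, f =O[𝓝[≠] 0] (fun t : ℝ => t ^ 5) →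
      g =O[𝓝[≠] 0] (fun _ => (1 : ℝ)) →
      (fun t => ⟪f t, g t⟫) =O[𝓝[≠] 0] fun t : ℝ => t ^ 5 := by
    intro f g hf hg
    have h1 : (fun t => ⟪f t, g t⟫) =O[𝓝[≠] 0] fun t => ‖f t‖ * ‖g t‖ :=
      IsBigO.of_bound 1 (Eventually.of_forall fun t => by
        simpa using abs_real_inner_le_norm (f t) (g t))
    refine (h1.trans (hf.norm_left.mul hg.norm_left)).congr_right fun t => by simp
  have h1 : (fun t => ⟪S t, S t⟫ - 2 * ⟪c, S t⟫) =O[𝓝[≠] 0] fun t : ℝ => t ^ 5 := by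
    have h2 := hinner _ _ hR (hγb.add hSb)
    have h3 := (hinner _ _ hR (isBigO_const_const c (one_ne_zero (α := ℝ)) _)).const_mul_left 2
    refine (h3.sub h2).congr' ?_ EventuallyEq.rfl
    filter_upwards [h] with t ht
    simp only [inner_sub_left, inner_add_right]
    rw [real_inner_comm c (γ t), real_inner_comm c (S t), real_inner_comm (γ t) (S t)]
    linarith
  let d : ℕ → ℝ := fun i => match i with
    | 0 => 0
    | 1 => -2 * ⟪c, p 1⟫
    | 2 => ⟪p 1, p 1⟫ - 2 * ⟪c, p 2⟫
    | 3 => 2 * ⟪p 1, p 2⟫ - 2 * ⟪c, p 3⟫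
    | _ => 2 * ⟪p 1, p 3⟫ + ⟪p 2, p 2⟫ - 2 * ⟪c, p 4⟫
  have h2 : (fun t : ℝ => ∑ i ∈ Finset.range 5, t ^ i • d i) =O[𝓝[≠] 0] fun t : ℝ => t ^ 5 := by
    have h3 : (fun t : ℝ => t ^ 5 * (2 * ⟪p 1, p 4⟫ + 2 * ⟪p 2, p 3⟫
        + t * (2 * ⟪p 2, p 4⟫ + ⟪p 3, p 3⟫) + t ^ 2 * (2 * ⟪p 3, p 4⟫)
        + t ^ 3 * ⟪p 4, p 4⟫)) =O[𝓝[≠] 0] fun t : ℝ => t ^ 5 := by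
      have h4 : (fun t : ℝ => (2 * ⟪p 1, p 4⟫ + 2 * ⟪p 2, p 3⟫
        + t * (2 * ⟪p 2, p 4⟫ + ⟪p 3, p 3⟫) + t ^ 2 * (2 * ⟪p 3, p 4⟫)
        + t ^ 3 * ⟪p 4, p 4⟫)) =O[𝓝[≠] 0] fun _ => (1 : ℝ) :=
        ((Continuous.tendsto (by fun_prop) 0).mono_left nhdsWithin_le_nhds).isBigO_one ℝ
      refine ((isBigO_refl (fun t : ℝ => t ^ 5) _).mul h4).congr_right fun t => by simp
    refine (h1.sub h3).congr_left fun t => ?_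
    simp only [hS, d, Finset.sum_range_succ, Finset.sum_range_zero, hp0, inner_add_left,
      inner_add_right, inner_smul_left, inner_smul_right, smul_eq_mul, smul_zero, zero_add,
      conj_trivial]
    rw [real_inner_comm (p 1) (p 2), real_inner_comm (p 1) (p 3), real_inner_comm (p 1) (p 4),
      real_inner_comm (p 2) (p 3), real_inner_comm (p 2) (p 4), real_inner_comm (p 3) (p 4)]
    ring
  have h3 := coeff_eq_zero_of_isBigO_pow 5 d h2
  have e1 := h3 1 (by norm_num)
  have e2 := h3 2 (by norm_num)
  have e3 := h3 3 (by norm_num)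
  have e4 := h3 4 (by norm_num)
  simp only [d] at e1 e2 e3 e4
  refine ⟨?_, ?_, ?_, ?_⟩ <;> linarith

end Jets

section Circles

theorem eventually_abs_lt {ε : ℝ} (hε : 0 < ε) : ∀ᶠ t : ℝ in 𝓝[≠] 0, |t| < ε := by
  refine nhdsWithin_le_nhds ?_
  filter_upwards [Metric.ball_mem_nhds (0 : ℝ) hε] with t ht
  simpa using ht

theorem exists_center_of_cospherical {E : Type*} [NormedAddCommGroup E] {γ : ℝ → E} (hγ0 : γ 0 = 0)
    {ε : ℝ} (hε : 0 < ε)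
    (h : EuclideanGeometry.Cospherical {z | ∃ t : ℝ, |t| < ε ∧ z = γ t}) :
    ∃ c : E, ∀ z ∈ {z | ∃ t : ℝ, |t| < ε ∧ z = γ t}, dist z c = ‖c‖ := by
  obtain ⟨c, R, h⟩ := h
  have h0 := h (γ 0) ⟨0, by simpa using hε, rfl⟩
  rw [hγ0, dist_zero_left] at h0
  exact ⟨c, fun z hz => by rw [h z hz, h0]⟩

variable {E : Type*} [NormedAddCommGroup E] [InnerProductSpace ℝ E]

theorem dist_eq_norm_iff_inner_self (z c : E) : dist z c = ‖c‖ ↔ ⟪z, z⟫ = 2 * ⟪c, z⟫ := by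
  rw [dist_eq_norm, ← sq_eq_sq₀ (norm_nonneg _) (norm_nonneg _), norm_sub_sq_real,
    real_inner_self_eq_norm_sq, real_inner_comm]
  constructor <;> intro h <;> linarith

theorem HasJet.sphere_of_dist {γ : ℝ → E} {p : ℕ → E} (hp : HasJet γ p) (hp0 : p 0 = 0)
    {ε : ℝ} (hε : 0 < ε) {c : E}
    (h : ∀ z ∈ {z | ∃ t : ℝ, |t| < ε ∧ z = γ t}, dist z c = ‖c‖) :
    ⟪c, p 1⟫ = 0 ∧ 2 * ⟪c, p 2⟫ = ⟪p 1, p 1⟫ ∧ ⟪c, p 3⟫ = ⟪p 1, p 2⟫ ∧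
      2 * ⟪c, p 4⟫ = 2 * ⟪p 1, p 3⟫ + ⟪p 2, p 2⟫ := by
  refine hp.sphere hp0 ?_
  filter_upwards [eventually_abs_lt hε] with t ht
  exact (dist_eq_norm_iff_inner_self _ _).1 (h _ ⟨t, ht, rfl⟩)

variable [FiniteDimensional ℝ E]

theorem HasJet.mem_vectorSpan {γ : ℝ → E} {p : ℕ → E} (hp : HasJet γ p) (hγ0 : γ 0 = 0)
    {ε : ℝ} (hε : 0 < ε) : ∀ i < 5, p i ∈ vectorSpan ℝ {z | ∃ t : ℝ, |t| < ε ∧ z = γ t} := by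
  refine hp.mem ?_
  filter_upwards [eventually_abs_lt hε] with t ht
  have h := vsub_mem_vectorSpan ℝ (s := {z | ∃ t : ℝ, |t| < ε ∧ z = γ t})
    (p₁ := γ t) (p₂ := γ 0) ⟨t, ht, rfl⟩ ⟨0, by simpa using hε, rfl⟩
  simpa [hγ0] using h

theorem inner_eq_of_mem_plane {W : Submodule ℝ E} (hW : Module.finrank ℝ W ≤ 2)
    {a b w c m : E} (ha : a ∈ W) (hb : b ∈ W) (hw : w ∈ W) (ha0 : a ≠ 0) (hca : ⟪c, a⟫ = 0)
    (hcb : 2 * ⟪c, b⟫ = ⟪a, a⟫) (hm : ⟪a, m⟫ = 0) :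
    ⟪a, a⟫ * ⟪w, m⟫ = 2 * ⟪c, w⟫ * ⟪b, m⟫ := by
  have hpos : ⟪a, a⟫ ≠ 0 := inner_self_ne_zero.2 ha0
  have hli : LinearIndependent ℝ ![a, b] := by
    rw [LinearIndependent.pair_iff]
    intro x y hxy
    have h1 : ⟪c, x • a + y • b⟫ = 0 := by rw [hxy, inner_zero_right]
    rw [inner_add_right, inner_smul_right, inner_smul_right, hca] at h1
    have hy : y = 0 := by
      have h2 : y * ⟪a, a⟫ = 0 := by rw [← hcb]; linear_combination 2 * h1
      exact (mul_eq_zero.1 h2).resolve_right hpos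
    subst hy
    simp only [zero_smul, add_zero, smul_eq_zero, ha0, or_false] at hxy
    exact ⟨hxy, rfl⟩
  have hspan : Submodule.span ℝ (Set.range ![a, b]) = W := by
    refine Submodule.eq_of_le_of_finrank_le ?_ ?_
    · rw [Submodule.span_le]
      rintro _ ⟨i, rfl⟩
      fin_cases i
      · exact ha
      · exact hb
    · rw [finrank_span_eq_card hli]
      simpa using hW
  rw [← hspan, Matrix.range_cons, Matrix.range_cons, Matrix.range_empty, Set.union_empty,
    Set.singleton_union, Submodule.mem_span_pair] at hw
  obtain ⟨x, y, rfl⟩ := hw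
  simp only [inner_add_left, inner_add_right, inner_smul_left, inner_smul_right, conj_trivial,
    hm, hca, ← hcb]
  ring

theorem inner_eq_zero_of_mem_line {W : Submodule ℝ E} (hW : Module.finrank ℝ W ≤ 1)
    {a w m : E} (ha : a ∈ W) (hw : w ∈ W) (ha0 : a ≠ 0) (hm : ⟪a, m⟫ = 0) : ⟪w, m⟫ = 0 := by
  obtain ⟨v, hv⟩ := finrank_le_one_iff.1 hW
  obtain ⟨x, hx⟩ := hv ⟨a, ha⟩
  obtain ⟨y, hy⟩ := hv ⟨w, hw⟩
  have hx : x • (v : E) = a := congrArg Subtype.val hx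
  have hy : y • (v : E) = w := congrArg Subtype.val hy
  rw [← hx, inner_smul_left, conj_trivial] at hm
  rw [← hy, inner_smul_left, conj_trivial]
  rcases mul_eq_zero.1 hm with h | h
  · exact absurd (by rw [← hx, h, zero_smul]) ha0
  · rw [h, mul_zero]

/-- The relations between the Taylor coefficients of a curve lying on a circle through `0`. -/
theorem HasJet.circle {γ : ℝ → E} {p : ℕ → E} (hp : HasJet γ p) (hp0 : p 0 = 0)
    (hγ0 : γ 0 = 0) {ε : ℝ} (hε : 0 < ε)
    (h : EuclideanGeometry.Concyclic {z | ∃ t : ℝ, |t| < ε ∧ z = γ t} ∨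
      Collinear ℝ {z | ∃ t : ℝ, |t| < ε ∧ z = γ t})
    (hp1 : p 1 ≠ 0) {m : E} (hm : ⟪p 1, m⟫ = 0) :
    ⟪p 1, p 1⟫ * ⟪p 3, m⟫ = 2 * ⟪p 1, p 2⟫ * ⟪p 2, m⟫ ∧
      ⟪p 1, p 1⟫ * ⟪p 4, m⟫ = (2 * ⟪p 1, p 3⟫ + ⟪p 2, p 2⟫) * ⟪p 2, m⟫ := by
  have hmem := hp.mem_vectorSpan hγ0 hε
  have m1 := hmem 1 (by norm_num)
  have m2 := hmem 2 (by norm_num)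
  have m3 := hmem 3 (by norm_num)
  have m4 := hmem 4 (by norm_num)
  rcases h with ⟨hs, hc⟩ | hc
  · obtain ⟨c, hc'⟩ := exists_center_of_cospherical hγ0 hε hs
    obtain ⟨e1, e2, e3, e4⟩ := hp.sphere_of_dist hp0 hε hc'
    have h3 := inner_eq_of_mem_plane hc.finrank_le_two m1 m2 m3 hp1 e1 e2 hm
    have h4 := inner_eq_of_mem_plane hc.finrank_le_two m1 m2 m4 hp1 e1 e2 hm
    rw [e3] at h3
    rw [e4] at h4
    exact ⟨h3, h4⟩
  · have key := fun w (hw : w ∈ vectorSpan ℝ {z | ∃ t : ℝ, |t| < ε ∧ z = γ t}) =>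
      inner_eq_zero_of_mem_line hc.finrank_le_one m1 hw hp1 hm
    rw [key _ m2, key _ m3, key _ m4]
    simp

end Circles

section Algebra

theorem eq_zero_of_mul_eq_zero_of_sq_eq_sq {x y : ℝ} (h : x * y = 0) (h' : x ^ 2 = y ^ 2) :
    x = 0 ∧ y = 0 := by
  rcases mul_eq_zero.1 h with rfl | rfl
  · exact ⟨rfl, by simpa using h'.symm⟩
  · exact ⟨by simpa using h', rfl⟩

theorem binary_form_of_dvd_mul {c₁ c₂ c₃ c₄ d₁ d₂ d₃ : ℝ}
    (h : ∀ a b : ℝ, (a ^ 2 + b ^ 2) * (d₁ * a ^ 2 + d₂ * (a * b) + d₃ * b ^ 2) =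
      2 * (c₁ * a ^ 2 + (c₂ + c₃) * (a * b) + c₄ * b ^ 2) *
        (c₃ * a ^ 2 + (c₄ - c₁) * (a * b) - c₂ * b ^ 2)) :
    c₁ = c₄ ∧ c₂ + c₃ = 0 := by
  have h1 := h 1 0
  have h2 := h 0 1
  have h3 := h 1 1
  have h4 := h 1 (-1)
  have h5 := h 1 2
  have := eq_zero_of_mul_eq_zero_of_sq_eq_sq (x := c₁ - c₄) (y := c₂ + c₃)
    (by nlinarith) (by nlinarith)
  exact ⟨sub_eq_zero.1 this.1, this.2⟩

theorem binary_form_of_dvd_sq {q₁ q₂ q₃ g₁ g₂ g₃ : ℝ}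
    (h : ∀ a b : ℝ, (q₁ * a ^ 2 + q₂ * (a * b) + q₃ * b ^ 2) ^ 2 =
      (a ^ 2 + b ^ 2) * (g₁ * a ^ 2 + g₂ * (a * b) + g₃ * b ^ 2)) :
    q₁ = q₃ ∧ q₂ = 0 := by
  have h1 := h 1 0
  have h2 := h 0 1
  have h3 := h 1 1
  have h4 := h 1 (-1)
  have h5 := h 1 2
  have := eq_zero_of_mul_eq_zero_of_sq_eq_sq (x := q₁ - q₃) (y := q₂)
    (by nlinarith) (by nlinarith)
  exact ⟨sub_eq_zero.1 this.1, this.2⟩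

variable {E : Type*} [NormedAddCommGroup E] [InnerProductSpace ℝ E]

/-- A bilinear form which is isotropic on every orthonormal pair is a multiple of the metric on the
diagonal. -/
theorem inner_map_self_eq_of_orthonormal_pairs {T : E →ₗ[ℝ] E} {e : E} (he : ‖e‖ = 1)
    (h : ∀ f : E, ‖f‖ = 1 → ⟪e, f⟫ = 0 → ⟪T e, e⟫ = ⟪T f, f⟫ ∧ ⟪T f, e⟫ + ⟪T e, f⟫ = 0) (y : E) :
    ⟪T y, y⟫ = ⟪T e, e⟫ * ⟪y, y⟫ := by
  have hee : ⟪e, e⟫ = 1 := by rw [real_inner_self_eq_norm_sq, he, one_pow]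
  obtain ⟨w, hw⟩ : ∃ w, w = y - ⟪e, y⟫ • e := ⟨_, rfl⟩
  have hy : y = ⟪e, y⟫ • e + w := by rw [hw]; abel
  have hew : ⟪e, w⟫ = 0 := by
    rw [hw, inner_sub_right, inner_smul_right, hee]; ring
  have hwe : ⟪w, e⟫ = 0 := by rw [real_inner_comm, hew]
  have key : ⟪T w, w⟫ = ⟪T e, e⟫ * ⟪w, w⟫ ∧ ⟪T w, e⟫ + ⟪T e, w⟫ = 0 := by
    by_cases hw0 : w = 0
    · simp [hw0]
    · have hn : ‖w‖ ≠ 0 := norm_ne_zero_iff.2 hw0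
      obtain ⟨h1, h2⟩ := h (‖w‖⁻¹ • w) (by rw [norm_smul, norm_inv, norm_norm, inv_mul_cancel₀ hn])
        (by rw [inner_smul_right, hew, mul_zero])
      simp only [map_smul, inner_smul_left, inner_smul_right, conj_trivial] at h1 h2
      rw [real_inner_self_eq_norm_sq]
      constructor
      · rw [h1]; field_simp
      · rw [← mul_add] at h2
        exact (mul_eq_zero.1 h2).resolve_left (inv_ne_zero hn)
  generalize ⟪e, y⟫ = a at hy
  rw [hy]
  simp only [map_add, map_smul, inner_add_left, inner_add_right, inner_smul_left, inner_smul_right,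
    conj_trivial, hew, hwe, hee]
  linear_combination key.1 + a * key.2

/-- The consequences of the relations between the Taylor coefficients of circles, on the fibre over
a fixed parameter. The coefficients are decomposed into homogeneous components. -/
theorem conformal_of_circle_relations {C₀ D₀ E₀ : E} {C D₁ E₁ : E →ₗ[ℝ] E} {D₂ E₂ E₃ : E → E}
    (hI : ∀ (s : ℝ) (y m : E), s • y ≠ 0 → ⟪y, m⟫ = 0 →
      ⟪s • y, s • y⟫ * ⟪D₀ + s • D₁ y + s ^ 2 • D₂ y, m⟫ =
        2 * ⟪s • y, C₀ + s • C y⟫ * ⟪C₀ + s • C y, m⟫)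
    (hII : ∀ (s : ℝ) (y m : E), s • y ≠ 0 → ⟪y, m⟫ = 0 →
      ⟪s • y, s • y⟫ * ⟪E₀ + s • E₁ y + s ^ 2 • E₂ y + s ^ 3 • E₃ y, m⟫ =
        (2 * ⟪s • y, D₀ + s • D₁ y + s ^ 2 • D₂ y⟫ + ⟪C₀ + s • C y, C₀ + s • C y⟫) *
          ⟪C₀ + s • C y, m⟫)
    {e : E} (he : ‖e‖ = 1) (hw : ∀ x : E, ∃ w : E, ‖w‖ = 1 ∧ ⟪x, w⟫ = 0) :
    C₀ = 0 ∧ (∀ y, ⟪C y, y⟫ = ⟪C e, e⟫ * ⟪y, y⟫) ∧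
      ∀ y, ⟪C y - ⟪C e, e⟫ • y, C y - ⟪C e, e⟫ • y⟫ =
        ⟪C e - ⟪C e, e⟫ • e, C e - ⟪C e, e⟫ • e⟫ * ⟪y, y⟫ := by
  have hC : ∀ y m : E, ⟪y, m⟫ = 0 → ⟪y, C₀⟫ * ⟪C₀, m⟫ = 0 ∧
      ⟪y, y⟫ * ⟪D₁ y, m⟫ = 2 * ⟪y, C y⟫ * ⟪C y, m⟫ := by
    intro y m hm
    by_cases hy : y = 0
    · simp [hy]
    have h := fun (s : ℝ) (hs : s ≠ 0) => hI s y m (smul_ne_zero hs hy) hm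
    simp only [inner_add_left, inner_add_right, inner_smul_left, inner_smul_right,
      conj_trivial] at h
    have h1 := h 1 (by norm_num)
    have h2 := h (-1) (by norm_num)
    have h3 := h 2 (by norm_num)
    have h4 := h (-2) (by norm_num)
    constructor <;> linarith
  have hC0 : C₀ = 0 := by
    obtain ⟨w, hw1, hw2⟩ := hw C₀
    have hww : ⟪w, w⟫ = 1 := by rw [real_inner_self_eq_norm_sq, hw1, one_pow]
    have hw2' : ⟪w, C₀⟫ = 0 := by rw [real_inner_comm, hw2]
    have h := (hC (C₀ + w) (C₀ - ⟪C₀, C₀⟫ • w) (by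
      simp only [inner_add_left, inner_sub_right, inner_smul_right, hw2, hw2', hww]; ring)).1
    simp only [inner_add_left, inner_sub_right, inner_smul_right, hw2, hw2'] at h
    simpa using h
  subst hC0
  have hD : ∀ y m : E, ⟪y, m⟫ = 0 → ⟪y, y⟫ * ⟪D₁ y, m⟫ = 2 * ⟪y, C y⟫ * ⟪C y, m⟫ := by
    exact fun y m hm => (hC y m hm).2
  have hCe : ∀ y, ⟪C y, y⟫ = ⟪C e, e⟫ * ⟪y, y⟫ := by
    refine inner_map_self_eq_of_orthonormal_pairs he fun f hf hef => ?_
    have hee : ⟪e, e⟫ = 1 := by rw [real_inner_self_eq_norm_sq, he, one_pow]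
    have hff : ⟪f, f⟫ = 1 := by rw [real_inner_self_eq_norm_sq, hf, one_pow]
    have hfe : ⟪f, e⟫ = 0 := by rw [real_inner_comm, hef]
    refine binary_form_of_dvd_mul (d₁ := ⟪D₁ e, f⟫) (d₂ := ⟪D₁ f, f⟫ - ⟪D₁ e, e⟫)
      (d₃ := -⟪D₁ f, e⟫) fun a b => ?_
    have h := hD (a • e + b • f) (-b • e + a • f) (by
      simp only [inner_add_left, inner_add_right, inner_smul_left, inner_smul_right,
        conj_trivial, hee, hff, hef, hfe]; ring)
    simp only [map_add, map_smul, inner_add_left, inner_add_right, inner_smul_left,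
      inner_smul_right, conj_trivial, hee, hff, hef, hfe] at h
    simp only [real_inner_comm (C _) e, real_inner_comm (C _) f] at h
    linear_combination h
  refine ⟨rfl, hCe, ?_⟩
  obtain ⟨l, hl⟩ : ∃ l, l = ⟪C e, e⟫ := ⟨_, rfl⟩
  rw [← hl] at hCe ⊢
  have hDe : ∀ y, ⟪D₁ y, y⟫ = ⟪D₁ e, e⟫ * ⟪y, y⟫ := by
    have hT : ∀ y m : E, ⟪y, m⟫ = 0 → ⟪(D₁ - (2 * l) • C) y, m⟫ = 0 := by
      intro y m hm
      by_cases hy : y = 0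
      · simp [hy]
      have h := hD y m hm
      rw [real_inner_comm (C y) y, hCe] at h
      have hpos : ⟪y, y⟫ ≠ 0 := inner_self_ne_zero.2 hy
      refine mul_left_cancel₀ hpos ?_
      simp only [LinearMap.sub_apply, LinearMap.smul_apply, inner_sub_left, inner_smul_left,
        conj_trivial]
      linear_combination h
    have h2 : ∀ y, ⟪(D₁ - (2 * l) • C) y, y⟫ = ⟪(D₁ - (2 * l) • C) e, e⟫ * ⟪y, y⟫ := by
      refine inner_map_self_eq_of_orthonormal_pairs he fun f hf hef => ?_
      have hee : ⟪e, e⟫ = 1 := by rw [real_inner_self_eq_norm_sq, he, one_pow]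
      have hff : ⟪f, f⟫ = 1 := by rw [real_inner_self_eq_norm_sq, hf, one_pow]
      have hfe : ⟪f, e⟫ = 0 := by rw [real_inner_comm, hef]
      have h3 := hT (e + f) (e - f) (by
        simp only [inner_add_left, inner_sub_right, hee, hff, hef, hfe]; ring)
      have h4 := hT e f hef
      have h5 := hT f e hfe
      rw [map_add, inner_add_left, inner_sub_right, inner_sub_right] at h3
      constructor <;> linarith
    intro y
    have h3 := h2 y
    have hee : ⟪e, e⟫ = 1 := by rw [real_inner_self_eq_norm_sq, he, one_pow]
    simp only [LinearMap.sub_apply, LinearMap.smul_apply, inner_sub_left, inner_smul_left,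
      conj_trivial, hCe, hee] at h3
    linear_combination h3
  obtain ⟨d, hd⟩ : ∃ d, d = ⟪D₁ e, e⟫ := ⟨_, rfl⟩
  rw [← hd] at hDe
  obtain ⟨B, hB⟩ : ∃ B : E →ₗ[ℝ] E, B = C - l • LinearMap.id := ⟨_, rfl⟩
  have hBC : ∀ y, C y - l • y = B y := fun y => by simp [hB]
  have hCB : ∀ y, C y = B y + l • y := fun y => by simp [hB]
  simp only [hBC]
  have hBy : ∀ y, ⟪B y, y⟫ = 0 := fun y => by
    rw [← hBC, inner_sub_left, hCe, inner_smul_left, conj_trivial, sub_self]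
  have hBy' : ∀ y, ⟪y, B y⟫ = 0 := fun y => by rw [real_inner_comm, hBy]
  have hquart : ∀ y, ⟪B y, B y⟫ ^ 2 =
      ⟪y, y⟫ * (⟪E₁ y, B y⟫ - (2 * d + l ^ 2) * ⟪B y, B y⟫) := by
    intro y
    by_cases hy : y = 0
    · simp [hy]
    have hpos : ⟪y, y⟫ ≠ 0 := inner_self_ne_zero.2 hy
    have h := fun (s : ℝ) (hs : s ≠ 0) => hII s y (B y) (smul_ne_zero hs hy) (hBy' y)
    simp only [hCB, inner_add_left, inner_add_right, inner_smul_left, inner_smul_right,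
      conj_trivial, hBy, hBy', inner_zero_left, inner_zero_right,
      real_inner_comm (D₁ y) y, hDe] at h
    have h1 := h 1 (by norm_num)
    have h2 := h (-1) (by norm_num)
    have h3 := h 2 (by norm_num)
    have h4 := h (-2) (by norm_num)
    linarith
  have hskew : ∀ x y, ⟪B x, y⟫ = -⟪x, B y⟫ := by
    intro x y
    have h := hBy (x + y)
    simp only [map_add, inner_add_left, inner_add_right, hBy] at h
    rw [real_inner_comm (B y) x]
    linarith
  have hBB : ∀ x y, ⟪(-(B ∘ₗ B)) x, y⟫ = ⟪B x, B y⟫ := fun x y => by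
    rw [LinearMap.neg_apply, inner_neg_left, LinearMap.comp_apply, hskew, neg_neg]
  have hfin := inner_map_self_eq_of_orthonormal_pairs (T := -(B ∘ₗ B)) he (fun f hf hef => by
    have hee : ⟪e, e⟫ = 1 := by rw [real_inner_self_eq_norm_sq, he, one_pow]
    have hff : ⟪f, f⟫ = 1 := by rw [real_inner_self_eq_norm_sq, hf, one_pow]
    have hfe : ⟪f, e⟫ = 0 := by rw [real_inner_comm, hef]
    rw [hBB, hBB, hBB, hBB]
    refine binary_form_of_dvd_sq (g₁ := ⟪E₁ e, B e⟫ - (2 * d + l ^ 2) * ⟪B e, B e⟫)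
      (g₂ := ⟪E₁ e, B f⟫ + ⟪E₁ f, B e⟫ - (2 * d + l ^ 2) * (⟪B f, B e⟫ + ⟪B e, B f⟫))
      (g₃ := ⟪E₁ f, B f⟫ - (2 * d + l ^ 2) * ⟪B f, B f⟫) fun a b => ?_
    have h := hquart (a • e + b • f)
    simp only [map_add, map_smul, inner_add_left, inner_add_right, inner_smul_left,
      inner_smul_right, conj_trivial, hee, hff, hef, hfe] at h
    linear_combination h)
  intro y
  have := hfin y
  rwa [hBB, hBB] at this

end Algebra

section Currying

variable (V F : Type*) [AddCommGroup V] [Module ℝ V] [AddCommGroup F] [Module ℝ F]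

/-- Currying of bilinear maps. -/
noncomputable def curryTwo :
    MultilinearMap ℝ (fun _ : Fin 2 => V) F →ₗ[ℝ] V →ₗ[ℝ] V →ₗ[ℝ] F :=
  LinearMap.llcomp ℝ V _ _ (MultilinearMap.ofSubsingletonₗ ℝ ℝ V F (0 : Fin 1)).symm.toLinearMap ∘ₗ
    (multilinearCurryLeftEquiv ℝ (fun _ : Fin 2 => V) F).toLinearMap

/-- Currying of trilinear maps. -/
noncomputable def curryThree :
    MultilinearMap ℝ (fun _ : Fin 3 => V) F →ₗ[ℝ] V →ₗ[ℝ] V →ₗ[ℝ] V →ₗ[ℝ] F :=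
  LinearMap.llcomp ℝ V _ _ (curryTwo V F) ∘ₗ
    (multilinearCurryLeftEquiv ℝ (fun _ : Fin 3 => V) F).toLinearMap

/-- Currying of quadrilinear maps. -/
noncomputable def curryFour :
    MultilinearMap ℝ (fun _ : Fin 4 => V) F →ₗ[ℝ] V →ₗ[ℝ] V →ₗ[ℝ] V →ₗ[ℝ] V →ₗ[ℝ] F :=
  LinearMap.llcomp ℝ V _ _ (curryThree V F) ∘ₗ
    (multilinearCurryLeftEquiv ℝ (fun _ : Fin 4 => V) F).toLinearMap

variable {V F}

theorem curryTwo_apply (f : MultilinearMap ℝ (fun _ : Fin 2 => V) F) (v w : V) :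
    curryTwo V F f v w = f (Fin.cons v fun _ => w) := rfl

theorem curryThree_apply (f : MultilinearMap ℝ (fun _ : Fin 3 => V) F) (u v w : V) :
    curryThree V F f u v w = f (Fin.cons u (Fin.cons v fun _ => w)) := rfl

theorem curryFour_apply (f : MultilinearMap ℝ (fun _ : Fin 4 => V) F) (t u v w : V) :
    curryFour V F f t u v w = f (Fin.cons t (Fin.cons u (Fin.cons v fun _ => w))) := rfl

theorem cons_const {α : Type*} (n : ℕ) (v : α) :
    (Fin.cons v fun _ => v : Fin (n + 1) → α) = fun _ => v := by
  ext i
  refine Fin.cases ?_ (fun _ => ?_) i <;> simp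

theorem curryTwo_diag (f : MultilinearMap ℝ (fun _ : Fin 2 => V) F) (v : V) :
    curryTwo V F f v v = f fun _ => v := by
  rw [curryTwo_apply, cons_const]

theorem curryThree_diag (f : MultilinearMap ℝ (fun _ : Fin 3 => V) F) (v : V) :
    curryThree V F f v v v = f fun _ => v := by
  rw [curryThree_apply, cons_const, cons_const]

theorem curryFour_diag (f : MultilinearMap ℝ (fun _ : Fin 4 => V) F) (v : V) :
    curryFour V F f v v v v = f fun _ => v := by
  rw [curryFour_apply, cons_const, cons_const, cons_const]

end Currying

section Germ

theorem exists_unit_inner_eq_zero {E : Type*} [NormedAddCommGroup E] [InnerProductSpace ℝ E]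
    [FiniteDimensional ℝ E] (hE : 2 ≤ Module.finrank ℝ E) (x : E) :
    ∃ w : E, ‖w‖ = 1 ∧ ⟪x, w⟫ = 0 := by
  have h1 : Module.finrank ℝ (Submodule.span ℝ {x}) ≤ 1 := by
    simpa using finrank_span_le_card (R := ℝ) ({x} : Set E)
  have h2 := Submodule.finrank_add_finrank_orthogonal (Submodule.span ℝ {x})
  have h3 : (Submodule.span ℝ {x})ᗮ ≠ ⊥ := fun h => by
    rw [h, finrank_bot] at h2
    omega
  obtain ⟨w, hw, hw0⟩ := Submodule.exists_mem_ne_zero_of_ne_bot h3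
  refine ⟨‖w‖⁻¹ • w, norm_smul_inv_norm hw0, ?_⟩
  rw [inner_smul_right, Submodule.mem_orthogonal_singleton_iff_inner_right.1 hw, mul_zero]

variable {A E : Type*} [NormedAddCommGroup A] [NormedSpace ℝ A]
  [NormedAddCommGroup E] [InnerProductSpace ℝ E]

theorem HasFPowerSeriesAt.hasJet {V : Type*} [NormedAddCommGroup V] [NormedSpace ℝ V] {f : V → E}
    {P : FormalMultilinearSeries ℝ V E} (hP : HasFPowerSeriesAt f P 0) (v : V) :
    HasJet (fun t : ℝ => f (t • v)) (fun i => P i fun _ => v) := by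
  have h1 : Tendsto (fun t : ℝ => t • v) (𝓝[≠] 0) (𝓝 0) := by
    have : Tendsto (fun t : ℝ => t • v) (𝓝 0) (𝓝 ((0 : ℝ) • v)) :=
      Continuous.tendsto (by fun_prop) 0
    rw [zero_smul] at this
    exact this.mono_left nhdsWithin_le_nhds
  have h2 := (hP.isBigO_sub_partialSum_pow 5).comp_tendsto h1
  have h3 : (fun t : ℝ => ‖t • v‖ ^ 5) =O[𝓝[≠] 0] fun t : ℝ => t ^ 5 :=
    IsBigO.of_bound (‖v‖ ^ 5) (Eventually.of_forall fun t => by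
      rw [norm_smul, norm_pow, norm_mul, norm_norm, norm_norm, norm_pow, mul_pow, mul_comm])
  refine (h2.trans h3).congr_left fun t => ?_
  simp only [Function.comp_apply, zero_add, FormalMultilinearSeries.partialSum]
  congr 1
  refine Finset.sum_congr rfl fun i _ => ?_
  rw [(P i).map_smul_univ (fun _ => t) (fun _ => v), Finset.prod_const, Finset.card_univ,
    Fintype.card_fin]

theorem exists_clifford_jet [FiniteDimensional ℝ E] (hE : 2 ≤ Module.finrank ℝ E) {Φ : A × E → E}
    (hΦ : AnalyticAt ℝ Φ 0) (hproj : ∀ᶠ x in 𝓝 (0 : E), Φ (0, x) = x)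
    (hcirc : ∀ v : A × E, ∃ ε > (0 : ℝ),
      EuclideanGeometry.Concyclic {z | ∃ t : ℝ, |t| < ε ∧ z = Φ (t • v)} ∨
        Collinear ℝ {z | ∃ t : ℝ, |t| < ε ∧ z = Φ (t • v)}) :
    ∃ (M : A →ₗ[ℝ] E) (l : A →ₗ[ℝ] ℝ) (B : A →ₗ[ℝ] Module.End ℝ E) (e : E), ‖e‖ = 1 ∧
      (∀ α x, ⟪B α x, x⟫ = 0) ∧
      (∀ α x, ⟪B α x, B α x⟫ = ⟪B α e, B α e⟫ * ⟪x, x⟫) ∧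
      ∀ α x, ∃ p : ℕ → E, HasJet (fun t : ℝ => Φ (t • (α, x))) p ∧ p 0 = 0 ∧
        p 1 = x + M α ∧ p 2 = l α • (x + M α) + B α (x + M α) := by
  obtain ⟨P, hP⟩ := hΦ
  have hjet := hP.hasJet
  have hΦ0 : Φ 0 = 0 := hproj.self_of_nhds
  let T₁ := (MultilinearMap.ofSubsingletonₗ ℝ ℝ (A × E) E (0 : Fin 1)).symm (P 1).toMultilinearMap
  let T₂ := curryTwo (A × E) E (P 2).toMultilinearMap
  let T₃ := curryThree (A × E) E (P 3).toMultilinearMap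
  let T₄ := curryFour (A × E) E (P 4).toMultilinearMap
  have hT₁ : ∀ v, (P 1 fun _ => v) = T₁ v := fun v => rfl
  have hT₂ : ∀ v, (P 2 fun _ => v) = T₂ v v := fun v => (curryTwo_diag _ v).symm
  have hT₃ : ∀ v, (P 3 fun _ => v) = T₃ v v v := fun v => (curryThree_diag _ v).symm
  have hT₄ : ∀ v, (P 4 fun _ => v) = T₄ v v v v := fun v => (curryFour_diag _ v).symm
  have hT₀ : ∀ v, (P 0 fun _ => v) = 0 := fun v => by
    rw [← hΦ0, ← hP.coeff_zero fun _ => v]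
  let j : E →ₗ[ℝ] A × E := LinearMap.inr ℝ A E
  have hfib : ∀ x : E, T₁ (j x) = x ∧ T₂ (j x) (j x) = 0 ∧ T₃ (j x) (j x) (j x) = 0 ∧
      T₄ (j x) (j x) (j x) (j x) = 0 := by
    intro x
    let q : ℕ → E := fun i => if i = 1 then x else 0
    have hq : HasJet (fun t : ℝ => Φ (t • j x)) q := by
      have h1 : HasJet (fun t : ℝ => t • x) q := by
        refine (isBigO_zero _ _).congr_left fun t => ?_
        simp [q]
      refine h1.congr ?_
      have h2 : Tendsto (fun t : ℝ => t • x) (𝓝 0) (𝓝 ((0 : ℝ) • x)) :=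
        Continuous.tendsto (by fun_prop) 0
      rw [zero_smul] at h2
      filter_upwards [nhdsWithin_le_nhds (h2.eventually hproj)] with t ht
      simp [j, ht]
    have h := (hjet (j x)).coeff_eq hq
    have h1 := h 1 (by norm_num)
    have h2 := h 2 (by norm_num)
    have h3 := h 3 (by norm_num)
    have h4 := h 4 (by norm_num)
    rw [hT₁] at h1
    rw [hT₂] at h2
    rw [hT₃] at h3
    rw [hT₄] at h4
    exact ⟨by simpa [q] using h1, by simpa [q] using h2, by simpa [q] using h3,
      by simpa [q] using h4⟩
  have hrel : ∀ v m, T₁ v ≠ 0 → ⟪T₁ v, m⟫ = 0 →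
      ⟪T₁ v, T₁ v⟫ * ⟪T₃ v v v, m⟫ = 2 * ⟪T₁ v, T₂ v v⟫ * ⟪T₂ v v, m⟫ ∧
      ⟪T₁ v, T₁ v⟫ * ⟪T₄ v v v v, m⟫ =
        (2 * ⟪T₁ v, T₃ v v v⟫ + ⟪T₂ v v, T₂ v v⟫) * ⟪T₂ v v, m⟫ := by
    intro v m hv hm
    obtain ⟨ε, hε, h⟩ := hcirc v
    have := (hjet v).circle (hT₀ v) (by simpa using hΦ0) hε h (by rwa [hT₁]) (m := m)
      (by rwa [hT₁])
    rwa [hT₁, hT₂, hT₃, hT₄] at this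
  let M : A →ₗ[ℝ] E := T₁ ∘ₗ LinearMap.inl ℝ A E
  let ι : A →ₗ[ℝ] A × E := LinearMap.prod LinearMap.id (-M)
  have hι : ∀ α, T₁ (ι α) = 0 := fun α => by
    have h1 : ι α = LinearMap.inl ℝ A E α - j (M α) := by
      ext <;> simp [ι, j]
    rw [h1, map_sub, (hfib _).1]
    simp [M]
  let C : A →ₗ[ℝ] E →ₗ[ℝ] E := T₂.compl₁₂ ι j + T₂.flip.compl₁₂ ι j
  have hC : ∀ α y, C α y = T₂ (ι α) (j y) + T₂ (j y) (ι α) := fun α y => rfl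
  obtain ⟨e, he, -⟩ := exists_unit_inner_eq_zero hE 0
  have hconf : ∀ α, T₂ (ι α) (ι α) = 0 ∧ (∀ y, ⟪C α y, y⟫ = ⟪C α e, e⟫ * ⟪y, y⟫) ∧
      ∀ y, ⟪C α y - ⟪C α e, e⟫ • y, C α y - ⟪C α e, e⟫ • y⟫ =
        ⟪C α e - ⟪C α e, e⟫ • e, C α e - ⟪C α e, e⟫ • e⟫ * ⟪y, y⟫ := by
    intro α
    let u := ι α
    let D₁ : E →ₗ[ℝ] E := (T₃ u u + (T₃ u).flip u + (T₃.flip u).flip u) ∘ₗ j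
    let E₁ : E →ₗ[ℝ] E := (T₄ u u u + (T₄ u u).flip u + ((T₄ u).flip u).flip u +
      ((T₄.flip u).flip u).flip u) ∘ₗ j
    have hD₁ : ∀ y, D₁ y = T₃ u u (j y) + T₃ u (j y) u + T₃ (j y) u u := fun y => rfl
    have hE₁ : ∀ y, E₁ y = T₄ u u u (j y) + T₄ u u (j y) u + T₄ u (j y) u u + T₄ (j y) u u u :=
      fun y => rfl
    have e₁ : ∀ (s : ℝ) y, T₁ (u + s • j y) = s • y := fun s y => by
      rw [map_add, map_smul, (hfib y).1, hι, zero_add]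
    have e₂ : ∀ (s : ℝ) y, T₂ (u + s • j y) (u + s • j y) = T₂ u u + s • C α y := fun s y => by
      have h := (hfib y).2.1
      simp only [map_add, map_smul, LinearMap.add_apply, LinearMap.smul_apply, hC, h]
      module
    have e₃ : ∀ (s : ℝ) y, T₃ (u + s • j y) (u + s • j y) (u + s • j y) =
        T₃ u u u + s • D₁ y +
          s ^ 2 • (T₃ u (j y) (j y) + T₃ (j y) u (j y) + T₃ (j y) (j y) u) := fun s y => by
      have h := (hfib y).2.2.1
      simp only [map_add, map_smul, LinearMap.add_apply, LinearMap.smul_apply, hD₁, h]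
      module
    have e₄ : ∀ (s : ℝ) y, T₄ (u + s • j y) (u + s • j y) (u + s • j y) (u + s • j y) =
        T₄ u u u u + s • E₁ y +
          s ^ 2 • (T₄ u u (j y) (j y) + T₄ u (j y) u (j y) + T₄ u (j y) (j y) u +
            T₄ (j y) u u (j y) + T₄ (j y) u (j y) u + T₄ (j y) (j y) u u) +
          s ^ 3 • (T₄ u (j y) (j y) (j y) + T₄ (j y) u (j y) (j y) + T₄ (j y) (j y) u (j y) +
            T₄ (j y) (j y) (j y) u) := fun s y => by
      have h := (hfib y).2.2.2
      simp only [map_add, map_smul, LinearMap.add_apply, LinearMap.smul_apply, hE₁, h]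
      module
    refine conformal_of_circle_relations (D₀ := T₃ u u u) (E₀ := T₄ u u u u) (D₁ := D₁) (E₁ := E₁)
      (D₂ := fun y => T₃ u (j y) (j y) + T₃ (j y) u (j y) + T₃ (j y) (j y) u)
      (E₂ := fun y => T₄ u u (j y) (j y) + T₄ u (j y) u (j y) + T₄ u (j y) (j y) u +
            T₄ (j y) u u (j y) + T₄ (j y) u (j y) u + T₄ (j y) (j y) u u)
      (E₃ := fun y => T₄ u (j y) (j y) (j y) + T₄ (j y) u (j y) (j y) + T₄ (j y) (j y) u (j y) +
            T₄ (j y) (j y) (j y) u) (fun s y m hy hm => ?_) (fun s y m hy hm => ?_) he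
      (exists_unit_inner_eq_zero hE)
    · have h := (hrel (u + s • j y) m (by rwa [e₁]) (by
        rw [e₁, inner_smul_left, hm, mul_zero])).1
      rwa [e₁, e₂, e₃] at h
    · have h := (hrel (u + s • j y) m (by rwa [e₁]) (by
        rw [e₁, inner_smul_left, hm, mul_zero])).2
      rwa [e₁, e₂, e₃, e₄] at h
  let l : A →ₗ[ℝ] ℝ := (innerSL ℝ e).toLinearMap ∘ₗ C.flip e
  have hl : ∀ α, l α = ⟪C α e, e⟫ := fun α => real_inner_comm _ _
  let B : A →ₗ[ℝ] Module.End ℝ E := C - l.smulRight (1 : Module.End ℝ E)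
  have hB : ∀ α y, B α y = C α y - ⟪C α e, e⟫ • y := fun α y => by
    rw [← hl]; rfl
  refine ⟨M, l, B, e, he, fun α x => ?_, fun α x => ?_, fun α x => ⟨_, hjet (α, x), hT₀ _, ?_, ?_⟩⟩
  · rw [hB, inner_sub_left, (hconf α).2.1, inner_smul_left, conj_trivial, sub_self]
  · rw [hB, hB]
    exact (hconf α).2.2 x
  · have h1 : (α, x) = ι α + j (x + M α) := by ext <;> simp [ι, j]
    rw [hT₁, h1, map_add, hι, (hfib _).1, zero_add]
  · have h1 : (α, x) = ι α + j (x + M α) := by ext <;> simp [ι, j]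
    rw [hT₂, h1, hB, hl, add_sub_cancel, hC, map_add T₂, LinearMap.add_apply,
      map_add (T₂ (ι α)), map_add (T₂ (j _)), (hconf α).1, (hfib _).2.1]
    abel

end Germ

section Clifford

variable {A E : Type*} [AddCommGroup A] [Module ℝ A] [NormedAddCommGroup E] [InnerProductSpace ℝ E]

theorem inner_map_eq_neg_of_inner_map_self {B : Module.End ℝ E} (h : ∀ x, ⟪B x, x⟫ = 0) (x y : E) :
    ⟪B x, y⟫ = -⟪x, B y⟫ := by
  have h1 := h (x + y)
  simp only [map_add, inner_add_left, inner_add_right, h] at h1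
  rw [real_inner_comm (B y) x]
  linarith

/-- A linear space of skew-adjoint conformal operators is a Clifford system. -/
theorem anticommutator_eq {B : A →ₗ[ℝ] Module.End ℝ E} {e : E} (hskew : ∀ α x, ⟪B α x, x⟫ = 0)
    (hconf : ∀ α x, ⟪B α x, B α x⟫ = ⟪B α e, B α e⟫ * ⟪x, x⟫) (α β : A) :
    B α * B β + B β * B α = (-2 * ⟪B α e, B β e⟫) • (1 : Module.End ℝ E) := by
  have hs := fun α => inner_map_eq_neg_of_inner_map_self (hskew α)
  have hpol : ∀ x, ⟪B α x, B β x⟫ = ⟪B α e, B β e⟫ * ⟪x, x⟫ := fun x => by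
    have h := hconf (α + β) x
    simp only [map_add, LinearMap.add_apply, inner_add_left, inner_add_right] at h
    rw [real_inner_comm (B α x) (B β x), real_inner_comm (B α e) (B β e)] at h
    linear_combination (1 / 2) * h - (1 / 2) * hconf α x - (1 / 2) * hconf β x
  rw [← sub_eq_zero]
  refine (LinearMap.IsSymmetric.inner_map_self_eq_zero ?_).1 ?_
  · intro x y
    simp only [LinearMap.sub_apply, LinearMap.add_apply, Module.End.mul_apply,
      LinearMap.smul_apply, Module.End.one_apply, inner_sub_left, inner_add_left, inner_sub_right,
      inner_add_right, inner_smul_left, inner_smul_right, conj_trivial, hs]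
    ring
  · intro x
    simp only [LinearMap.sub_apply, LinearMap.add_apply, Module.End.mul_apply,
      LinearMap.smul_apply, Module.End.one_apply, inner_sub_left, inner_add_left, inner_smul_left,
      conj_trivial]
    rw [hs α (B β x) x, hs β (B α x) x, real_inner_comm (B α x) (B β x), hpol]
    ring

theorem exists_clifford_system [FiniteDimensional ℝ E] {B : A →ₗ[ℝ] Module.End ℝ E} {e : E}
    (hskew : ∀ α x, ⟪B α x, x⟫ = 0)
    (hconf : ∀ α x, ⟪B α x, B α x⟫ = ⟪B α e, B α e⟫ * ⟪x, x⟫) (hB : ∀ α, B α = 0 → α = 0) :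
    ∃ (s : ℕ) (I : Fin s → Module.End ℝ E) (L : A →ₗ[ℝ] EuclideanSpace ℝ (Fin s)),
      (∀ j x y, ⟪I j x, y⟫ = -⟪x, I j y⟫) ∧ (∀ j, I j * I j = -1) ∧ (∀ j x, ‖I j x‖ = ‖x‖) ∧
      (∀ j m, j ≠ m → I j * I m + I m * I j = 0) ∧ Function.Injective L ∧
      ∀ α, ∑ j, L α j • I j = B α := by
  let J : A →ₗ[ℝ] E := LinearMap.applyₗ e ∘ₗ B
  have hJ : Function.Injective J := by
    rw [← LinearMap.ker_eq_bot, LinearMap.ker_eq_bot']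
    intro α hα
    have hα : B α e = 0 := hα
    refine hB α (LinearMap.ext fun x => ?_)
    have h := hconf α x
    rw [hα, inner_zero_left, zero_mul] at h
    exact inner_self_eq_zero.1 h
  let φ := LinearEquiv.ofInjective J hJ
  let u := stdOrthonormalBasis ℝ (LinearMap.range J)
  have hφ : ∀ w, B (φ.symm w) e = w := fun w =>
    congrArg Subtype.val (φ.apply_symm_apply w)
  have hI : ∀ j m, B (φ.symm (u j)) * B (φ.symm (u m)) + B (φ.symm (u m)) * B (φ.symm (u j)) =
      ((-2 : ℝ) * if j = m then 1 else 0) • (1 : Module.End ℝ E) := fun j m => by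
    rw [anticommutator_eq hskew hconf, hφ, hφ, ← Submodule.coe_inner,
      orthonormal_iff_ite.1 u.orthonormal]
  have hself : ∀ j x, ⟪B (φ.symm (u j)) x, B (φ.symm (u j)) x⟫ = ⟪x, x⟫ := fun j x => by
    rw [hconf, hφ, ← Submodule.coe_inner, orthonormal_iff_ite.1 u.orthonormal, if_pos rfl, one_mul]
  refine ⟨_, fun j => B (φ.symm (u j)), u.repr.toLinearEquiv.toLinearMap ∘ₗ φ.toLinearMap,
    fun j x y => inner_map_eq_neg_of_inner_map_self (hskew _) x y, fun j => ?_, fun j x => ?_,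
    fun j m hjm => ?_, u.repr.toLinearEquiv.injective.comp φ.injective, fun α => ?_⟩
  · have h := hI j j
    rw [if_pos rfl, ← two_smul ℝ, mul_one, neg_smul, ← smul_neg] at h
    exact (smul_right_inj (two_ne_zero (α := ℝ))).1 h
  · rw [← sq_eq_sq₀ (norm_nonneg _) (norm_nonneg _), ← real_inner_self_eq_norm_sq,
      ← real_inner_self_eq_norm_sq, hself]
  · rw [hI, if_neg hjm, mul_zero, zero_smul]
  · have h := u.sum_repr (φ α)
    simp only [← map_smul, ← map_sum]
    rw [show B α = B (φ.symm (φ α)) by rw [φ.symm_apply_apply]]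
    congr 2

theorem exists_eq_smul_of_one_sub_smul_apply_eq {B : A →ₗ[ℝ] Module.End ℝ E} {e : E}
    (hskew : ∀ α x, ⟪B α x, x⟫ = 0)
    (hconf : ∀ α x, ⟪B α x, B α x⟫ = ⟪B α e, B α e⟫ * ⟪x, x⟫) {α : A} {t : ℝ} {x y : E}
    (h : (1 - t • B α) x = t • y) :
    ∃ κ : ℝ, κ * (1 + t ^ 2 * ⟪B α e, B α e⟫) = t ∧ x = κ • (y + t • B α y) := by
  set μ : ℝ := ⟪B α e, B α e⟫ with hμ
  have hpos : 0 < 1 + t ^ 2 * μ := by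
    have : 0 ≤ μ := real_inner_self_nonneg
    positivity
  have hsq : B α (B α x) = -μ • x := by
    have h2 := LinearMap.congr_fun (anticommutator_eq hskew hconf α α) x
    simp only [LinearMap.add_apply, Module.End.mul_apply, LinearMap.smul_apply,
      Module.End.one_apply, ← hμ] at h2
    linear_combination (norm := module) (1 / 2 : ℝ) • h2
  have hx : x = t • y + t • B α x := by
    rw [← h]
    simp
  refine ⟨t / (1 + t ^ 2 * μ), div_mul_cancel₀ _ hpos.ne', ?_⟩
  have hBx : B α x = t • B α y + t • B α (B α x) := by
    rw [← map_smul, ← map_smul, ← map_add, ← hx]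
  rw [hsq] at hBx
  rw [div_eq_inv_mul, mul_smul, eq_inv_smul_iff₀ hpos.ne']
  linear_combination (norm := module) hx + t • hBx

/-- If a curve is contained in a circle, then so is its union with any set of points of the form
`κ • (y + t • z)` with `κ * (1 + t ^ 2 * μ) = t`, where `y`, `z` are determined by the second order
jet of the curve. -/
theorem HasJet.circle_union [FiniteDimensional ℝ E] {γ : ℝ → E} {p : ℕ → E} (hp : HasJet γ p)
    (hp0 : p 0 = 0) (hγ0 : γ 0 = 0) {ε : ℝ} (hε : 0 < ε)
    (h : EuclideanGeometry.Concyclic {z | ∃ t : ℝ, |t| < ε ∧ z = γ t} ∨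
      Collinear ℝ {z | ∃ t : ℝ, |t| < ε ∧ z = γ t})
    {y z : E} {l μ : ℝ} (hp1 : p 1 = y) (hp2 : p 2 = l • y + z) (hyz : ⟪z, y⟫ = 0)
    (hz : ⟪z, z⟫ = μ * ⟪y, y⟫) {S : Set E}
    (hS : ∀ x ∈ S, ∃ t κ : ℝ, κ * (1 + t ^ 2 * μ) = t ∧ x = κ • (y + t • z)) :
    EuclideanGeometry.Concyclic ({z | ∃ t : ℝ, |t| < ε ∧ z = γ t} ∪ S) ∨
      Collinear ℝ ({z | ∃ t : ℝ, |t| < ε ∧ z = γ t} ∪ S) := by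
  set C := {z | ∃ t : ℝ, |t| < ε ∧ z = γ t} with hC
  have hmem := hp.mem_vectorSpan hγ0 hε
  rw [← hC] at hmem
  have hy : y ∈ vectorSpan ℝ C := hp1 ▸ hmem 1 (by norm_num)
  have hz' : z ∈ vectorSpan ℝ C := by
    have h2 := hmem 2 (by norm_num)
    rw [hp2] at h2
    exact (Submodule.add_mem_iff_right _ (Submodule.smul_mem _ _ hy)).1 h2
  have h0 : (0 : E) ∈ C := ⟨0, by simpa using hε, hγ0.symm⟩
  have h0' : (0 : E) ∈ C ∪ S := Or.inl h0
  have hle : vectorSpan ℝ (C ∪ S) ≤ vectorSpan ℝ C := by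
    rw [vectorSpan_eq_span_vsub_set_right ℝ h0', Submodule.span_le]
    rintro _ ⟨x, hx | hx, rfl⟩
    · exact vsub_mem_vectorSpan ℝ hx h0
    · obtain ⟨t, κ, -, rfl⟩ := hS x hx
      simp only [vsub_eq_sub, sub_zero]
      exact Submodule.smul_mem _ _ (Submodule.add_mem _ hy (Submodule.smul_mem _ _ hz'))
  refine h.imp (fun h => ⟨?_, (Submodule.rank_mono hle).trans h.2⟩)
    fun h => (Submodule.rank_mono hle).trans h
  obtain ⟨c, hc⟩ := exists_center_of_cospherical hγ0 hε h.1
  obtain ⟨e1, e2, -, -⟩ := hp.sphere_of_dist hp0 hε hc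
  refine ⟨c, ‖c‖, ?_⟩
  rintro x (hx | hx)
  · exact hc x hx
  · obtain ⟨t, κ, hκ, rfl⟩ := hS x hx
    have hzy : ⟪y, z⟫ = 0 := by rw [real_inner_comm, hyz]
    rw [hp1] at e1
    rw [hp1, hp2, inner_add_right, inner_smul_right, e1] at e2
    rw [dist_eq_norm_iff_inner_self]
    simp only [inner_add_left, inner_add_right, inner_smul_left, inner_smul_right, conj_trivial,
      hyz, hzy, hz, e1]
    linear_combination κ * ⟪y, y⟫ * hκ - κ * t * e2

end Clifford

end CircleJets

/-- Micro-local theorem: a real-analytic local projection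
`Φ : (ℝ^r × ℝ^n, 0) → (ℝ^n, 0)` taking germs of vector lines to circles, such that the
images of lines not lying in `ℝ^n` do not degenerate to lines, sends each vector line
to the same circle as a map `F(β,x) = (id - ∑ⱼ βⱼ • Iⱼ)⁻¹ x` built from a
representation of a Clifford algebra `Cliff(s)` (given by skew-adjoint,
norm-preserving, pairwise anticommuting operators `Iⱼ` with `Iⱼ² = -id`), composed
with an injective affine-linear change of variables `ψ(α,x) = (Lα, x + Mα)`.  The
value `F(t•Lα, t•(x₀+Mα))` is encoded as the `y` with
`(id - ∑ⱼ (t·(Lα)ⱼ) • Iⱼ) y = t • (x₀ + Mα)`, the operator being invertible. -/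
theorem stmt12 (n r : ℕ) (hn : 2 ≤ n) (hr : 1 ≤ r)
    (U : Set (EuclideanSpace ℝ (Fin r) × EuclideanSpace ℝ (Fin n)))
    (hU : U ∈ nhds (0 : EuclideanSpace ℝ (Fin r) × EuclideanSpace ℝ (Fin n)))
    (Φ : EuclideanSpace ℝ (Fin r) × EuclideanSpace ℝ (Fin n) → EuclideanSpace ℝ (Fin n))
    (hΦ : AnalyticOnNhd ℝ Φ U)
    (hproj : ∀ x : EuclideanSpace ℝ (Fin n), ((0, x) : _ × _) ∈ U → Φ (0, x) = x)
    (hcirc : ∀ v : EuclideanSpace ℝ (Fin r) × EuclideanSpace ℝ (Fin n),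
      ∃ ε > (0 : ℝ), (∀ t : ℝ, |t| < ε → t • v ∈ U) ∧
        (EuclideanGeometry.Concyclic {z | ∃ t : ℝ, |t| < ε ∧ z = Φ (t • v)} ∨
          Collinear ℝ {z | ∃ t : ℝ, |t| < ε ∧ z = Φ (t • v)}))
    (hnondeg : ∀ (α : EuclideanSpace ℝ (Fin r)) (x₀ : EuclideanSpace ℝ (Fin n)),
      α ≠ 0 → x₀ ≠ 0 → ∀ ε > (0 : ℝ),
        (∀ t : ℝ, |t| < ε → t • ((α, x₀) : _ × _) ∈ U) →
        ¬ Collinear ℝ {z | ∃ t : ℝ, |t| < ε ∧ z = Φ (t • ((α, x₀) : _ × _))}) :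
    ∃ (s : ℕ) (I : Fin s → Module.End ℝ (EuclideanSpace ℝ (Fin n)))
      (L : EuclideanSpace ℝ (Fin r) →ₗ[ℝ] EuclideanSpace ℝ (Fin s))
      (M : EuclideanSpace ℝ (Fin r) →ₗ[ℝ] EuclideanSpace ℝ (Fin n)),
      (∀ j, ∀ x y : EuclideanSpace ℝ (Fin n), ⟪I j x, y⟫ = -⟪x, I j y⟫) ∧
      (∀ j, I j * I j = -1) ∧
      (∀ j, ∀ x : EuclideanSpace ℝ (Fin n), ‖I j x‖ = ‖x‖) ∧
      (∀ j m, j ≠ m → I j * I m + I m * I j = 0) ∧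
      (Function.Injective fun α : EuclideanSpace ℝ (Fin r) => (L α, M α)) ∧
      (∀ (α : EuclideanSpace ℝ (Fin r)) (x₀ : EuclideanSpace ℝ (Fin n)),
        ∃ ε > (0 : ℝ), (∀ t : ℝ, |t| < ε → t • ((α, x₀) : _ × _) ∈ U) ∧
          (EuclideanGeometry.Concyclic
              ({z | ∃ t : ℝ, |t| < ε ∧ z = Φ (t • ((α, x₀) : _ × _))} ∪
                {y | ∃ t : ℝ,
                  IsUnit ((1 : Module.End ℝ (EuclideanSpace ℝ (Fin n)))
                      - ∑ j, (t * L α j) • I j) ∧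
                  ((1 : Module.End ℝ (EuclideanSpace ℝ (Fin n)))
                      - ∑ j, (t * L α j) • I j) y = t • (x₀ + M α)}) ∨
            Collinear ℝ
              ({z | ∃ t : ℝ, |t| < ε ∧ z = Φ (t • ((α, x₀) : _ × _))} ∪
                {y | ∃ t : ℝ,
                  IsUnit ((1 : Module.End ℝ (EuclideanSpace ℝ (Fin n)))
                      - ∑ j, (t * L α j) • I j) ∧
                  ((1 : Module.End ℝ (EuclideanSpace ℝ (Fin n)))
                      - ∑ j, (t * L α j) • I j) y = t • (x₀ + M α)}))) := by
  obtain ⟨M, l, B, e, he, hskew, hconf, hjet⟩ := exists_clifford_jet (Φ := Φ)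
    (by rwa [finrank_euclideanSpace_fin]) (hΦ 0 (mem_of_mem_nhds hU))
    (((Continuous.prodMk_right 0).tendsto' 0 0 rfl).eventually hU |>.mono hproj)
    fun v => (hcirc v).imp fun ε hε => ⟨hε.1, hε.2.2⟩
  have hB : ∀ α, B α = 0 → α = 0 := by
    intro α hα
    by_contra hne
    obtain ⟨x, hx, hy⟩ : ∃ x, x ≠ 0 ∧ x + M α ≠ 0 := by
      have he0 : e ≠ 0 := fun h => by simp [h] at he
      by_cases h : e + M α = 0
      · refine ⟨(2 : ℝ) • e, smul_ne_zero two_ne_zero he0, ?_⟩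
        rwa [two_smul, add_assoc, h, add_zero]
      · exact ⟨e, he0, h⟩
    obtain ⟨p, hp, hp0, hp1, hp2⟩ := hjet α x
    have hγ0 : Φ ((0 : ℝ) • (α, x)) = 0 := by
      rw [zero_smul]
      exact hproj 0 (mem_of_mem_nhds hU)
    obtain ⟨ε, hε, hεU, h | h⟩ := hcirc (α, x)
    · obtain ⟨c, hc⟩ := exists_center_of_cospherical hγ0 hε h.1
      obtain ⟨e1, e2, -, -⟩ := hp.sphere_of_dist hp0 hε hc
      rw [hp1] at e1
      rw [hp1, hp2, hα, LinearMap.zero_apply, add_zero, inner_smul_right, e1, mul_zero,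
        mul_zero] at e2
      exact hy (inner_self_eq_zero.1 e2.symm)
    · exact hnondeg α x hne hx ε hε hεU h
  obtain ⟨s, I, L, hIskew, hIsq, hInorm, hIanti, hL, hLB⟩ :=
    exists_clifford_system hskew hconf hB
  refine ⟨s, I, L, M, hIskew, hIsq, hInorm, hIanti, fun α β h => hL (congrArg Prod.fst h),
    fun α x => ?_⟩
  obtain ⟨ε, hε, hεU, h⟩ := hcirc (α, x)
  refine ⟨ε, hε, hεU, ?_⟩
  obtain ⟨p, hp, hp0, hp1, hp2⟩ := hjet α x
  have hγ0 : Φ ((0 : ℝ) • (α, x)) = 0 := by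
    rw [zero_smul]
    exact hproj 0 (mem_of_mem_nhds hU)
  refine hp.circle_union hp0 hγ0 hε h hp1 hp2 (hskew α _) (hconf α _) ?_
  rintro y ⟨t, -, hy⟩
  have hsum : ∑ j, (t * L α j) • I j = t • B α := by
    rw [← hLB, Finset.smul_sum]
    simp only [mul_smul]
  rw [hsum] at hy
  exact ⟨t, exists_eq_smul_of_one_sub_smul_apply_eq hskew hconf hy⟩
end

section
/- For quaternions a, b ∈ ℍ define the ℝ-linear operator M(a,b) on ℍ × ℍ by M(a,b)(x, y) = (a·x − y·conj(b), x·b + conj(a)·y) (i.e. the block operator [[L_a, −R_{conj b}],[R_b, L_{conj a}]] built from left and right multiplications). Then for all a, b with Re(a) = 0, M(a,b) ∘ M(a,b) = −(‖a‖² + ‖b‖²) • id. Consequently, letting V = { (a,b) ∈ ℍ × ℍ : Re(a) = 0 } (a 7-dimensional real inner product space with ‖(a,b)‖² = ‖a‖² + ‖b‖²) and Q(v) = −‖v‖², there exists an ℝ-algebra homomorphism φ : CliffordAlgebra Q →ₐ[ℝ] (ℍ × ℍ →ₗ[ℝ] ℍ × ℍ) with φ(ι(a,b)) = M(a,b) for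 all (a,b) ∈ V: a representation of Cliff(7) on ℝ⁸. -/
theorem Quaternion.mul_star_eq_norm_sq (a : Quaternion ℝ) :
    a * star a = ((‖a‖ ^ 2 : ℝ) : Quaternion ℝ) := by
  rw [Quaternion.self_mul_star, Quaternion.normSq_eq_norm_mul_self, sq]

theorem Quaternion.star_mul_eq_norm_sq (a : Quaternion ℝ) :
    star a * a = ((‖a‖ ^ 2 : ℝ) : Quaternion ℝ) := by
  rw [Quaternion.star_mul_self, Quaternion.normSq_eq_norm_mul_self, sq]

theorem Quaternion.mul_self_eq_neg_norm_sq {a : Quaternion ℝ} (ha : a.re = 0) :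
    a * a = -((‖a‖ ^ 2 : ℝ) : Quaternion ℝ) := by
  rw [← Quaternion.mul_star_eq_norm_sq, Quaternion.star_eq_neg.mpr ha, mul_neg, neg_neg]


/-- The block operators `M(a,b) = [[L_a, -R_{conj b}], [R_b, L_{conj a}]]` on `ℍ × ℍ`
satisfy `M(a,b)² = -(‖a‖² + ‖b‖²) • id` when `Re a = 0`, and hence give a
representation of `Cliff(7)` — the Clifford algebra of `Q(v) = -‖v‖²` on the
7-dimensional space `V = {(a,b) : Re a = 0}` — on `ℝ⁸ = ℍ × ℍ`. -/
theorem stmt15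
    (M : Quaternion ℝ × Quaternion ℝ →
      (Quaternion ℝ × Quaternion ℝ →ₗ[ℝ] Quaternion ℝ × Quaternion ℝ))
    (hM : ∀ a b x y : Quaternion ℝ,
      M (a, b) (x, y) = (a * x - y * star b, x * b + star a * y))
    (V : Submodule ℝ (Quaternion ℝ × Quaternion ℝ))
    (hV : ∀ p : Quaternion ℝ × Quaternion ℝ, p ∈ V ↔ p.1.re = 0)
    (Q : QuadraticForm ℝ V)
    (hQ : ∀ v : V, Q v =
      -(‖(v : Quaternion ℝ × Quaternion ℝ).1‖ ^ 2
        + ‖(v : Quaternion ℝ × Quaternion ℝ).2‖ ^ 2)) :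
    (∀ a b : Quaternion ℝ, a.re = 0 →
      M (a, b) ∘ₗ M (a, b)
        = -((‖a‖ ^ 2 + ‖b‖ ^ 2) •
            (LinearMap.id : Quaternion ℝ × Quaternion ℝ →ₗ[ℝ] Quaternion ℝ × Quaternion ℝ))) ∧
    (∃ φ : CliffordAlgebra Q →ₐ[ℝ]
        (Quaternion ℝ × Quaternion ℝ →ₗ[ℝ] Quaternion ℝ × Quaternion ℝ),
      ∀ v : V, φ (CliffordAlgebra.ι Q v) = M (v : Quaternion ℝ × Quaternion ℝ)) := by
  have hsq : ∀ a b : Quaternion ℝ, a.re = 0 →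
      M (a, b) ∘ₗ M (a, b)
        = -((‖a‖ ^ 2 + ‖b‖ ^ 2) •
            (LinearMap.id : Quaternion ℝ × Quaternion ℝ →ₗ[ℝ] Quaternion ℝ × Quaternion ℝ)) := by
    intro a b ha
    refine LinearMap.ext fun ⟨x, y⟩ => ?_
    have haa := Quaternion.mul_self_eq_neg_norm_sq ha
    rw [LinearMap.comp_apply, hM, hM, Quaternion.star_eq_neg.mpr ha]
    refine Prod.ext ?_ ?_
    · calc a * (a * x - y * star b) - (x * b + -a * y) * star b
          = a * a * x - x * (b * star b) := by noncomm_ring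
        _ = -((‖a‖ ^ 2 + ‖b‖ ^ 2) • x) := by
          rw [haa, Quaternion.mul_star_eq_norm_sq, neg_mul, Quaternion.coe_mul_eq_smul,
            Quaternion.mul_coe_eq_smul, add_smul]
          abel
    · calc (a * x - y * star b) * b + -a * (x * b + -a * y)
          = a * a * y - y * (star b * b) := by noncomm_ring
        _ = -((‖a‖ ^ 2 + ‖b‖ ^ 2) • y) := by
          rw [haa, Quaternion.star_mul_eq_norm_sq, neg_mul, Quaternion.coe_mul_eq_smul,
            Quaternion.mul_coe_eq_smul, add_smul]
          abel
  refine ⟨hsq, ?_⟩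
  let f : V →ₗ[ℝ] Module.End ℝ (Quaternion ℝ × Quaternion ℝ) :=
    { toFun := fun v => M v
      map_add' := by
        rintro ⟨⟨a, b⟩, _⟩ ⟨⟨c, d⟩, _⟩
        refine LinearMap.ext fun ⟨x, y⟩ => ?_
        simp only [Submodule.coe_add, Prod.mk_add_mk, LinearMap.add_apply, hM, star_add]
        exact Prod.ext (by noncomm_ring) (by noncomm_ring)
      map_smul' := by
        rintro r ⟨⟨a, b⟩, _⟩
        refine LinearMap.ext fun ⟨x, y⟩ => ?_
        simp [hM, smul_sub, smul_add] }
  have hf : ∀ v : V, f v * f v = algebraMap ℝ _ (Q v) := by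
    rintro ⟨⟨a, b⟩, hv⟩
    rw [hQ, Algebra.algebraMap_eq_smul_one, neg_smul]
    exact hsq a b ((hV _).mp hv)
  exact ⟨CliffordAlgebra.lift Q ⟨f, hf⟩, fun v => CliffordAlgebra.lift_ι_apply f hf v⟩
end

section
/- Let r ≥ 1, n ≥ 1, and let Γ : ℝ^r × ℝ^n → ℝ^n be a bilinear map such that for every α ∈ ℝ^r there exists q(α) ∈ ℝ with ‖Γ(α, x)‖² = q(α)·‖x‖² for all x ∈ ℝ^n (each operator Γ(α, ·) is conformal), and such that Γ(α, ·) is not the zero operator whenever α ≠ 0. Then α ↦ q(α) is a positive definite quadratic form on ℝ^r: q(α) > 0 for α ≠ 0, q(t•α) = t²·q(α), and the polarization (α, β) ↦ q(α+β) − q(α) − q(β) is bilinear. In particular, after equipping ℝ^r with the Euclidean structure defined by q, one has ‖Γ(α, x)‖ = ‖α‖_q · ‖x‖ for all α and x. -/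
/-- If `Γ : ℝ^r × ℝ^n → ℝ^n` is bilinear, each operator `Γ(α, ·)` is conformal with
factor `q(α)` and is nonzero for `α ≠ 0`, then `q` is a positive definite quadratic
form on `ℝ^r`, and `‖Γ(α,x)‖ = √(q α) · ‖x‖` for all `α, x`. -/
theorem stmt17 (r n : ℕ) (hr : 1 ≤ r) (hn : 1 ≤ n)
    (Γ : EuclideanSpace ℝ (Fin r) →ₗ[ℝ]
      EuclideanSpace ℝ (Fin n) →ₗ[ℝ] EuclideanSpace ℝ (Fin n))
    (q : EuclideanSpace ℝ (Fin r) → ℝ)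
    (hq : ∀ (α : EuclideanSpace ℝ (Fin r)) (x : EuclideanSpace ℝ (Fin n)),
      ‖Γ α x‖ ^ 2 = q α * ‖x‖ ^ 2)
    (hnz : ∀ α : EuclideanSpace ℝ (Fin r), α ≠ 0 → Γ α ≠ 0) :
    (∀ α : EuclideanSpace ℝ (Fin r), α ≠ 0 → 0 < q α) ∧
    (∀ (t : ℝ) (α : EuclideanSpace ℝ (Fin r)), q (t • α) = t ^ 2 * q α) ∧
    (∃ B : EuclideanSpace ℝ (Fin r) →ₗ[ℝ] EuclideanSpace ℝ (Fin r) →ₗ[ℝ] ℝ,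
      ∀ α β : EuclideanSpace ℝ (Fin r), B α β = q (α + β) - q α - q β) ∧
    (∀ (α : EuclideanSpace ℝ (Fin r)) (x : EuclideanSpace ℝ (Fin n)),
      ‖Γ α x‖ = Real.sqrt (q α) * ‖x‖) := by
  obtain ⟨e, he⟩ : ∃ e : EuclideanSpace ℝ (Fin n), ‖e‖ = 1 :=
    ⟨EuclideanSpace.single ⟨0, hn⟩ 1, by simp⟩
  have hqe (α : EuclideanSpace ℝ (Fin r)) : q α = ‖Γ α e‖ ^ 2 := by simp [hq, he]
  have hq0 (α : EuclideanSpace ℝ (Fin r)) : 0 ≤ q α := by rw [hqe]; positivity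
  refine ⟨fun α hα => (hq0 α).lt_of_ne' fun h => hnz α hα ?_, fun t α => ?_, ?_, fun α x => ?_⟩
  · ext1 x
    simpa [h] using hq α x
  · simp [hqe, norm_smul, mul_pow]
  · refine ⟨(2 : ℝ) • (innerₗ _).compl₁₂ (Γ.flip e) (Γ.flip e), fun α β => ?_⟩
    simp only [LinearMap.smul_apply, LinearMap.compl₁₂_apply, LinearMap.flip_apply,
      innerₗ_apply_apply, smul_eq_mul, hqe, map_add, LinearMap.add_apply, norm_add_sq_real]
    ring
  · rw [← sq_eq_sq₀ (by positivity) (by positivity), mul_pow, Real.sq_sqrt (hq0 α), hq]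
end
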